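/- arXiv:1712.04091 — 2 statements merged into one kernel-verified Lean document; each statement's English description precedes it below -/
import Mathlib

section
/- Let K be a k-dimensional subspace of the space H^q(ℝⁿ × ℝ⁻) of ancient solutions of the heat equation on ℝⁿ of polynomial growth of degree at most q, and let {u_1,…,u_k} be any basis of K. Then there is a constant C = C(n), depending only on n, such that for every (x₀,t₀) ∈ ℝⁿ × (-∞,0], every R ≥ 1 and every ε ∈ (0,1], one has Σ_{i=1}^k ∫_{P_R(x₀,t₀)} u_i² dx dt ≤ C(n) ε^{-(n+1)} sup { ∫_{P_{(1+ε)R}(x₀,t₀)} (Σ_{i=1}^k a_i u_i)² dx dt : a_i ∈ [0,1], Σ_{i=1}^k a_i² = 1 }. -/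
open MeasureTheory Real

noncomputable section

/-- Spatial Laplacian of `f : ℝⁿ → ℝ` at `x` (sum of second partial derivatives). -/
def lap (n : ℕ) (f : EuclideanSpace ℝ (Fin n) → ℝ) (x : EuclideanSpace ℝ (Fin n)) : ℝ :=
  ∑ i : Fin n, fderiv ℝ (fun y => fderiv ℝ f y (EuclideanSpace.single i 1)) x
    (EuclideanSpace.single i 1)

/-- `u` is a smooth ancient solution of the heat equation on `ℝⁿ × (-∞, 0]`:
it is smooth and satisfies `Δ_x u = ∂_t u` for all `t ≤ 0`. -/
def IsAncientHeat (n : ℕ) (u : EuclideanSpace ℝ (Fin n) × ℝ → ℝ) : Prop :=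
  ContDiff ℝ (⊤ : ℕ∞) u ∧ ∀ (x : EuclideanSpace ℝ (Fin n)) (t : ℝ), t ≤ 0 →
    lap n (fun y => u (y, t)) x = deriv (fun s => u (x, s)) t

/-- `u` belongs to `H^q(ℝⁿ × ℝ⁻)`: an ancient solution of the heat equation of
polynomial growth of degree at most `q`. -/
def InHq (n : ℕ) (q : ℝ) (u : EuclideanSpace ℝ (Fin n) × ℝ → ℝ) : Prop :=
  IsAncientHeat n u ∧ ∃ c₀ : ℝ, 0 < c₀ ∧
    ∀ (x : EuclideanSpace ℝ (Fin n)) (t : ℝ), t ≤ 0 →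
      |u (x, t)| ≤ c₀ * (‖x‖ + Real.sqrt |t| + 1) ^ q

/-- The truncated paraboloid `P_r(x₀,t₀) = {(y,s) : |y−x₀| + √|t₀−s| ≤ r, s ≤ t₀}`. -/
def Pb (n : ℕ) (r : ℝ) (x₀ : EuclideanSpace ℝ (Fin n)) (t₀ : ℝ) :
    Set (EuclideanSpace ℝ (Fin n) × ℝ) :=
  {p | dist p.1 x₀ + Real.sqrt |t₀ - p.2| ≤ r ∧ p.2 ≤ t₀}

/-- The partial derivative of `f` in the `i`-th coordinate direction. -/
def pd {n : ℕ} (i : Fin n) (f : EuclideanSpace ℝ (Fin n) → ℝ) (x : EuclideanSpace ℝ (Fin n)) : ℝ :=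
  fderiv ℝ f x (EuclideanSpace.single i 1)

lemma lap_eq_sum_pd {n : ℕ} (f : EuclideanSpace ℝ (Fin n) → ℝ) (x : EuclideanSpace ℝ (Fin n)) :
    lap n f x = ∑ i, pd i (pd i f) x := rfl

section Calculus

variable {n : ℕ} {f g w : EuclideanSpace ℝ (Fin n) → ℝ}

lemma ContDiff.pd {k m : WithTop ℕ∞} (hf : ContDiff ℝ k f) (hk : m + 1 ≤ k) (i : Fin n) :
    ContDiff ℝ m (pd i f) :=
  (hf.fderiv_right hk).clm_apply contDiff_const

lemma HasCompactSupport.pd (hf : HasCompactSupport f) (i : Fin n) :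
    HasCompactSupport (pd i f) :=
  hf.fderiv_apply ℝ _

lemma ContDiff.continuous_lap (hf : ContDiff ℝ 2 f) : Continuous (lap n f) := by
  have : lap n f = fun x => ∑ i, _root_.pd i (_root_.pd i f) x := rfl
  rw [this]
  refine continuous_finsetSum _ fun i _ => ?_
  exact ((hf.pd (m := 1) (by norm_num) i).pd (m := 0) (by norm_num) i).continuous

lemma pd_mul (hf : Differentiable ℝ f) (hg : Differentiable ℝ g) (i : Fin n) :
    pd i (fun x => f x * g x) = fun x => pd i f x * g x + f x * pd i g x := by
  ext x
  simp only [pd]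
  rw [fderiv_fun_mul (hf x) (hg x)]
  simp
  ring

lemma pd_add (hf : Differentiable ℝ f) (hg : Differentiable ℝ g) (i : Fin n) :
    pd i (fun x => f x + g x) = fun x => pd i f x + pd i g x := by
  ext x
  simp only [pd]
  rw [fderiv_fun_add (hf x) (hg x)]
  simp

lemma lap_mul (hf : ContDiff ℝ 2 f) (hg : ContDiff ℝ 2 g) (x : EuclideanSpace ℝ (Fin n)) :
    lap n (fun y => f y * g y) x =
      lap n f x * g x + (2 * ∑ i, pd i f x * pd i g x + f x * lap n g x) := by
  have df := hf.differentiable (by norm_num)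
  have dg := hg.differentiable (by norm_num)
  have dpf i : Differentiable ℝ (pd i f) :=
    (hf.pd (m := 1) (by norm_num) i).differentiable (by norm_num)
  have dpg i : Differentiable ℝ (pd i g) :=
    (hg.pd (m := 1) (by norm_num) i).differentiable (by norm_num)
  have key i : pd i (pd i (fun y => f y * g y)) x =
      pd i (pd i f) x * g x + (2 * (pd i f x * pd i g x) + f x * pd i (pd i g) x) := by
    rw [pd_mul df dg, pd_add (f := fun x => pd i f x * g x) (g := fun x => f x * pd i g x)
      ((dpf i).mul dg) (df.mul (dpg i)), pd_mul (dpf i) dg,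
      pd_mul df (dpg i)]
    ring
  simp only [lap_eq_sum_pd, key, Finset.sum_add_distrib, Finset.sum_mul, Finset.mul_sum]

lemma integral_pd_mul (hf : ContDiff ℝ 1 f) (hw : ContDiff ℝ 1 w) (hc : HasCompactSupport w)
    (i : Fin n) : ∫ y, pd i f y * w y = - ∫ y, f y * pd i w y := by
  have cf : Continuous (pd i f) := (hf.pd (m := 0) (by norm_num) i).continuous
  have cw : Continuous (pd i w) := (hw.pd (m := 0) (by norm_num) i).continuous
  have := integral_mul_fderiv_eq_neg_fderiv_mul_of_integrable (μ := volume) (f := f) (g := w)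
    (v := EuclideanSpace.single i 1)
    ((cf.mul hw.continuous).integrable_of_hasCompactSupport hc.mul_left)
    ((hf.continuous.mul cw).integrable_of_hasCompactSupport (hc.pd i).mul_left)
    ((hf.continuous.mul hw.continuous).integrable_of_hasCompactSupport hc.mul_left)
    (fun x _ => hf.differentiable (by norm_num) x) (fun x _ => hw.differentiable (by norm_num) x)
  exact (neg_eq_iff_eq_neg.mpr this).symm

/-- Green's identity against a compactly supported function. -/
lemma integral_lap_mul (hf : ContDiff ℝ 2 f) (hw : ContDiff ℝ 2 w) (hc : HasCompactSupport w) :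
    ∫ y, lap n f y * w y = ∫ y, f y * lap n w y := by
  have hf1 i := hf.pd (m := 1) (by norm_num) i
  have hw1 i := hw.pd (m := 1) (by norm_num) i
  simp only [lap_eq_sum_pd, Finset.sum_mul, Finset.mul_sum]
  rw [integral_finsetSum, integral_finsetSum]
  · refine Finset.sum_congr rfl fun i _ => ?_
    rw [integral_pd_mul (hf1 i) (hw.of_le (by norm_num)) hc,
      integral_pd_mul (hf.of_le (by norm_num)) (hw1 i) (hc.pd i), neg_neg]
  · exact fun i _ => (hf.continuous.mul ((hw1 i).pd (m := 0) (by norm_num) i).continuous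
      ).integrable_of_hasCompactSupport ((hc.pd i).pd i).mul_left
  · exact fun i _ => (((hf1 i).pd (m := 0) (by norm_num) i).continuous.mul hw.continuous
      ).integrable_of_hasCompactSupport hc.mul_left

end Calculus

section HeatKernel

/-- The heat kernel of `ℝⁿ`, without the factor `(4π)^(-n/2)`. -/
def heatKer (n : ℕ) (τ : ℝ) (y : EuclideanSpace ℝ (Fin n)) : ℝ :=
  exp (-(n / 2 * log τ) - ‖y‖ ^ 2 / (4 * τ))

variable {n : ℕ}

lemma heatKer_pos (τ : ℝ) (y : EuclideanSpace ℝ (Fin n)) : 0 < heatKer n τ y := exp_pos _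

lemma contDiff_heatKer (τ : ℝ) {k : WithTop ℕ∞} : ContDiff ℝ k (heatKer n τ) := by
  unfold heatKer
  exact (contDiff_const.sub ((contDiff_norm_sq ℝ).div_const _)).exp

lemma continuousOn_heatKer :
    ContinuousOn (fun p : EuclideanSpace ℝ (Fin n) × ℝ => heatKer n p.2 p.1) {p | 0 < p.2} := by
  unfold heatKer
  refine ContinuousOn.rexp (ContinuousOn.sub ?_ ?_)
  · exact (continuousOn_const.mul
      (continuousOn_snd.log fun p hp => (ne_of_gt hp))).neg
  · exact ContinuousOn.div (by fun_prop) (by fun_prop)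
      fun p hp => (mul_pos (by norm_num) hp).ne'

lemma pd_heatKer (τ : ℝ) (i : Fin n) :
    pd i (heatKer n τ) = fun y => -(y i / (2 * τ)) * heatKer n τ y := by
  ext y
  have h : HasFDerivAt (heatKer n τ)
      (heatKer n τ y • (-((4 * τ)⁻¹ • (2 • innerSL ℝ y)) : EuclideanSpace ℝ (Fin n) →L[ℝ] ℝ)) y := by
    have h1 : HasFDerivAt (fun y : EuclideanSpace ℝ (Fin n) => ‖y‖ ^ 2) (2 • innerSL ℝ y) y :=
      (hasStrictFDerivAt_norm_sq y).hasFDerivAt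
    have h2 := (((h1.const_mul (4 * τ)⁻¹).const_sub (-(n / 2 * log τ)))).exp
    refine HasFDerivAt.congr_of_eventuallyEq (h2.congr_fderiv ?_) (.of_forall fun z => ?_)
    · simp only [heatKer, div_eq_inv_mul]
    · simp only [heatKer, div_eq_inv_mul]
  simp only [pd, h.fderiv]
  simp
  rw [EuclideanSpace.inner_single_right]
  simp
  field_simp
  norm_num

lemma pd_pd_heatKer (τ : ℝ) (i : Fin n) (y : EuclideanSpace ℝ (Fin n)) :
    pd i (pd i (heatKer n τ)) y =
      (-(1 / (2 * τ)) + y i ^ 2 / (4 * τ ^ 2)) * heatKer n τ y := by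
  have hl : Differentiable ℝ (fun y : EuclideanSpace ℝ (Fin n) => -(y i / (2 * τ))) := by
    fun_prop
  have hp : pd i (fun y : EuclideanSpace ℝ (Fin n) => -(y i / (2 * τ))) y = -(1 / (2 * τ)) := by
    have h0 : HasFDerivAt (fun y : EuclideanSpace ℝ (Fin n) => y i)
      (EuclideanSpace.proj i : EuclideanSpace ℝ (Fin n) →L[ℝ] ℝ) y :=
      (EuclideanSpace.proj i : EuclideanSpace ℝ (Fin n) →L[ℝ] ℝ).hasFDerivAt
    have h1 := (h0.mul_const (2 * τ)⁻¹).fun_neg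
    simp only [pd, div_eq_mul_inv]
    rw [HasFDerivAt.fderiv h1]
    simp
  rw [pd_heatKer, pd_mul hl ((contDiff_heatKer τ (k := 1)).differentiable (by norm_num))]
  beta_reduce
  rw [hp, pd_heatKer]
  ring

lemma lap_heatKer (τ : ℝ) (y : EuclideanSpace ℝ (Fin n)) :
    lap n (heatKer n τ) y = (-(n / (2 * τ)) + ‖y‖ ^ 2 / (4 * τ ^ 2)) * heatKer n τ y := by
  simp only [lap_eq_sum_pd, pd_pd_heatKer]
  rw [← Finset.sum_mul, Finset.sum_add_distrib, ← Finset.sum_div, EuclideanSpace.norm_sq_eq]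
  simp
  left
  ring

/-- The heat kernel solves the heat equation. -/
lemma hasDerivAt_heatKer {τ : ℝ} (hτ : 0 < τ) (y : EuclideanSpace ℝ (Fin n)) :
    HasDerivAt (fun τ => heatKer n τ y) (lap n (heatKer n τ) y) τ := by
  have h1 : HasDerivAt (fun τ : ℝ => -(n / 2 * log τ) - ‖y‖ ^ 2 / (4 * τ))
      (-(n / 2 * τ⁻¹) - (0 * (4 * τ) - ‖y‖ ^ 2 * (4 * 1)) / (4 * τ) ^ 2) τ :=
    ((hasDerivAt_log hτ.ne').const_mul _).neg.sub
      ((hasDerivAt_const τ _).div ((hasDerivAt_id τ).const_mul 4) (by positivity))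
  refine h1.exp.congr_deriv ?_
  rw [lap_heatKer, heatKer]
  field_simp
  ring

end HeatKernel

section Cutoff

variable {n : ℕ}

/-- A smooth cutoff function which is `1` on the ball of radius `1/4` and supported in the ball of
radius `1/2`. -/
def cutoff (n : ℕ) : EuclideanSpace ℝ (Fin n) → ℝ :=
  (⟨1 / 4, 1 / 2, by norm_num, by norm_num⟩ : ContDiffBump (0 : EuclideanSpace ℝ (Fin n)))

lemma contDiff_cutoff {k : ℕ∞} : ContDiff ℝ k (cutoff n) := ContDiffBump.contDiff _

lemma hasCompactSupport_cutoff : HasCompactSupport (cutoff n) := ContDiffBump.hasCompactSupport _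

lemma cutoff_nonneg (y : EuclideanSpace ℝ (Fin n)) : 0 ≤ cutoff n y := ContDiffBump.nonneg _

lemma cutoff_le_one (y : EuclideanSpace ℝ (Fin n)) : cutoff n y ≤ 1 := ContDiffBump.le_one _

lemma cutoff_zero : cutoff n 0 = 1 :=
  ContDiffBump.one_of_mem_closedBall _ (Metric.mem_closedBall_self (by norm_num))

lemma cutoff_eq_zero {y : EuclideanSpace ℝ (Fin n)} (hy : y ∉ Metric.closedBall 0 (1 / 2)) :
    cutoff n y = 0 :=
  ContDiffBump.zero_of_le_dist _ (by simpa using le_of_lt (by simpa using hy))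

lemma pd_eq_zero_of_eventuallyEq_const {f : EuclideanSpace ℝ (Fin n) → ℝ} {c : ℝ}
    {y : EuclideanSpace ℝ (Fin n)} (h : f =ᶠ[nhds y] fun _ => c) (i : Fin n) : pd i f y = 0 := by
  simp [pd, h.fderiv_eq]

lemma lap_eq_zero_of_eventuallyEq_const {f : EuclideanSpace ℝ (Fin n) → ℝ} {c : ℝ}
    {y : EuclideanSpace ℝ (Fin n)} (h : f =ᶠ[nhds y] fun _ => c) : lap n f y = 0 := by
  rw [lap_eq_sum_pd]
  refine Finset.sum_eq_zero fun i _ => pd_eq_zero_of_eventuallyEq_const (c := 0) ?_ i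
  filter_upwards [h.eventuallyEq_nhds] with z hz using pd_eq_zero_of_eventuallyEq_const hz i

lemma cutoff_eventuallyEq_const {y : EuclideanSpace ℝ (Fin n)}
    (hy : ‖y‖ < 1 / 4 ∨ 1 / 2 < ‖y‖) : ∃ c : ℝ, cutoff n =ᶠ[nhds y] fun _ => c := by
  rcases hy with hy | hy
  · exact ⟨1, ContDiffBump.eventuallyEq_one_of_mem_ball _ (by simpa using hy)⟩
  · refine ⟨0, ?_⟩
    have : (Metric.closedBall (0 : EuclideanSpace ℝ (Fin n)) (1 / 2))ᶜ ∈ nhds y :=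
      Metric.isClosed_closedBall.isOpen_compl.mem_nhds (by simpa using hy)
    filter_upwards [this] with z hz using cutoff_eq_zero hz

/-- The commutator `Δ(ηΓ) - ηΔΓ` of the cutoff `η` with the Laplacian, applied to the heat
kernel `Γ`. -/
def heatComm (n : ℕ) (τ : ℝ) (y : EuclideanSpace ℝ (Fin n)) : ℝ :=
  2 * ∑ i, pd i (heatKer n τ) y * pd i (cutoff n) y + heatKer n τ y * lap n (cutoff n) y

lemma heatComm_eq_zero (τ : ℝ) {y : EuclideanSpace ℝ (Fin n)}
    (hy : ‖y‖ < 1 / 4 ∨ 1 / 2 < ‖y‖) : heatComm n τ y = 0 := by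
  obtain ⟨c, hc⟩ := cutoff_eventuallyEq_const hy
  simp [heatComm, pd_eq_zero_of_eventuallyEq_const hc, lap_eq_zero_of_eventuallyEq_const hc]

lemma lap_heatKer_mul_cutoff (τ : ℝ) (y : EuclideanSpace ℝ (Fin n)) :
    lap n (fun y => heatKer n τ y * cutoff n y) y =
      lap n (heatKer n τ) y * cutoff n y + heatComm n τ y :=
  lap_mul (contDiff_heatKer τ) contDiff_cutoff y

lemma heatKer_le {τ : ℝ} (h0 : 0 < τ) (h1 : τ ≤ 1) {y : EuclideanSpace ℝ (Fin n)}
    (hy : 1 / 4 ≤ ‖y‖) : 1 / τ * heatKer n τ y ≤ 64 ^ (n + 1) * (n + 1).factorial := by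
  have hx : (0 : ℝ) ≤ 1 / (64 * τ) := by positivity
  have hlog : log τ ≤ 0 := log_nonpos h0.le h1
  have e1 : heatKer n τ y ≤ (1 / τ) ^ n * exp (-(1 / (64 * τ))) := by
    have : (1 / τ) ^ n = exp (-(n * log τ)) := by
      rw [exp_neg, mul_comm, exp_mul, exp_log h0, rpow_natCast, one_div, inv_pow]
    rw [this, ← exp_add, heatKer, exp_le_exp]
    have a1 : -(n / 2 * log τ) ≤ -(n * log τ) := by
      have : (n : ℝ) * log τ ≤ 0 := mul_nonpos_of_nonneg_of_nonpos (by positivity) hlog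
      linarith
    have a2 : 1 / (64 * τ) ≤ ‖y‖ ^ 2 / (4 * τ) := by
      rw [div_le_div_iff₀ (by positivity) (by positivity)]
      nlinarith [mul_le_mul hy hy (by norm_num) (norm_nonneg y)]
    linarith
  have e2 := pow_div_factorial_le_exp _ hx (n + 1)
  rw [div_le_iff₀ (by positivity)] at e2
  calc 1 / τ * heatKer n τ y ≤ 1 / τ * ((1 / τ) ^ n * exp (-(1 / (64 * τ)))) := by gcongr
    _ = 64 ^ (n + 1) * (1 / (64 * τ)) ^ (n + 1) * exp (-(1 / (64 * τ))) := by
      have : 64 * (1 / (64 * τ)) = 1 / τ := by field_simp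
      rw [← mul_pow, this, pow_succ]
      ring
    _ ≤ 64 ^ (n + 1) * (exp (1 / (64 * τ)) * (n + 1).factorial) * exp (-(1 / (64 * τ))) := by
      gcongr
    _ = 64 ^ (n + 1) * (n + 1).factorial := by
      rw [exp_neg]
      field_simp

lemma exists_abs_heatComm_le (n : ℕ) : ∃ C : ℝ, 0 ≤ C ∧ ∀ τ : ℝ, 0 < τ → τ ≤ 1 →
    ∀ y : EuclideanSpace ℝ (Fin n), |heatComm n τ y| ≤ C := by
  obtain ⟨M, hM⟩ : ∃ M : ℝ, ∀ y, |lap n (cutoff n) y| ≤ M := by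
    have hcs : HasCompactSupport (lap n (cutoff n)) := by
      refine HasCompactSupport.intro (isCompact_closedBall 0 (1 / 2)) fun y hy => ?_
      obtain ⟨c, hc⟩ := cutoff_eventuallyEq_const (n := n) (y := y) (Or.inr (by simpa using hy))
      exact lap_eq_zero_of_eventuallyEq_const hc
    exact hcs.exists_bound_of_continuous contDiff_cutoff.continuous_lap
  have hN i : ∃ N : ℝ, ∀ y, |pd i (cutoff n) y| ≤ N :=
    (hasCompactSupport_cutoff.pd i).exists_bound_of_continuous
      ((contDiff_cutoff (k := 1)).pd (m := 0) (by norm_num) i).continuous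
  choose N hN using hN
  have hM0 : 0 ≤ M := (abs_nonneg _).trans (hM 0)
  have hN0 i : 0 ≤ N i := (abs_nonneg _).trans (hN i 0)
  set A : ℝ := 64 ^ (n + 1) * (n + 1).factorial with hA
  have hA0 : 0 ≤ A := by positivity
  have hC : 0 ≤ 2 * ∑ i, A * N i + A * M := by
    have := Finset.sum_nonneg fun i (_ : i ∈ Finset.univ) => mul_nonneg hA0 (hN0 i)
    positivity
  refine ⟨2 * ∑ i, A * N i + A * M, hC, fun τ h0 h1 y => ?_⟩
  by_cases hy : ‖y‖ < 1 / 4 ∨ 1 / 2 < ‖y‖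
  · simpa [heatComm_eq_zero τ hy] using hC
  push Not at hy
  have hG := (heatKer_pos τ y).le
  have k0 : 1 / τ * heatKer n τ y ≤ A := heatKer_le h0 h1 hy.1
  have k1 : |heatKer n τ y| ≤ A := by
    rw [abs_of_nonneg hG]
    refine le_trans ?_ k0
    exact le_mul_of_one_le_left hG (by rw [le_div_iff₀ h0]; linarith)
  have k2 i : |pd i (heatKer n τ) y| ≤ A := by
    rw [pd_heatKer, abs_mul, abs_of_nonneg hG]
    refine le_trans (mul_le_mul_of_nonneg_right ?_ hG) k0
    have : |y i| ≤ ‖y‖ := by simpa using PiLp.norm_apply_le y i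
    rw [abs_neg, abs_div, abs_of_pos (by positivity : 0 < 2 * τ),
      div_le_div_iff₀ (by positivity) h0]
    nlinarith
  refine (abs_add_le _ _).trans (add_le_add ?_ ?_)
  · rw [abs_mul, abs_two]
    refine mul_le_mul_of_nonneg_left ((Finset.abs_sum_le_sum_abs _ _).trans ?_) (by norm_num)
    refine Finset.sum_le_sum fun i _ => ?_
    rw [abs_mul]
    exact mul_le_mul (k2 i) (hN i y) (abs_nonneg _) hA0
  · rw [abs_mul]
    exact mul_le_mul k1 (hM y) (abs_nonneg _) hA0

end Cutoff

section Representation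

variable {n : ℕ}

lemma integrable_prod_of_continuousOn {f : ℝ → EuclideanSpace ℝ (Fin n) → ℝ} {a b r : ℝ}
    (hf : ContinuousOn (Function.uncurry f) (Set.Icc a b ×ˢ Set.univ))
    (h0 : ∀ s y, y ∉ Metric.closedBall 0 r → f s y = 0) (hab : a ≤ b) :
    Integrable (Function.uncurry f) ((volume.restrict (Set.uIoc a b)).prod volume) := by
  rw [Measure.restrict_prod_eq_prod_univ, Set.uIoc_of_le hab]
  have h1 : IntegrableOn (Function.uncurry f) (Set.Icc a b ×ˢ Metric.closedBall 0 r)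
      (volume.prod volume) :=
    (hf.mono (Set.prod_mono_right (Set.subset_univ _))).integrableOn_compact
      (isCompact_Icc.prod (isCompact_closedBall 0 r))
  refine (h1.of_forall_sdiff_eq_zero (t := Set.Icc a b ×ˢ Set.univ)
    (measurableSet_Icc.prod .univ) ?_).mono_set (Set.prod_mono_left Set.Ioc_subset_Icc_self)
  rintro ⟨s, y⟩ ⟨⟨hs, -⟩, hy⟩
  exact h0 s y fun h => hy ⟨hs, h⟩

lemma deriv_snd_eq_fderiv {F : EuclideanSpace ℝ (Fin n) × ℝ → ℝ} (hF : Differentiable ℝ F)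
    (y : EuclideanSpace ℝ (Fin n)) (s : ℝ) :
    HasDerivAt (fun s => F (y, s)) (fderiv ℝ F (y, s) (0, 1)) s := by
  have h1 : HasDerivAt (fun s : ℝ => (y, s)) ((0 : EuclideanSpace ℝ (Fin n)), (1 : ℝ)) s :=
    (hasDerivAt_const s y).prodMk (hasDerivAt_id s)
  exact (hF (y, s)).hasFDerivAt.comp_hasDerivAt s h1

/-- Evolution of the localized heat-kernel average of a solution of the backward heat equation. -/
lemma integral_heatKer_mul_cutoff_sub {F : EuclideanSpace ℝ (Fin n) × ℝ → ℝ}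
    (hF : ContDiff ℝ 2 F)
    (heat : ∀ y s, 0 ≤ s → lap n (fun y => F (y, s)) y = -deriv (fun s => F (y, s)) s)
    {δ S : ℝ} (hδ : 0 < δ) (hS : 0 ≤ S) :
    (∫ y, F (y, S) * (heatKer n (S + δ) y * cutoff n y)) -
      ∫ y, F (y, 0) * (heatKer n (0 + δ) y * cutoff n y) =
      -∫ s in 0..S, ∫ y, F (y, s) * heatComm n (s + δ) y := by
  have dF : Differentiable ℝ F := hF.differentiable (by norm_num)
  have cF : Continuous F := hF.continuous
  have cDF : Continuous fun p => fderiv ℝ F p (0, 1) :=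
    ((hF.fderiv_right (m := 0) (by norm_num)).clm_apply contDiff_const).continuous
  have cη : Continuous (cutoff n) := (contDiff_cutoff (k := 0)).continuous
  set g' : ℝ → EuclideanSpace ℝ (Fin n) → ℝ := fun s y =>
    fderiv ℝ F (y, s) (0, 1) * (heatKer n (s + δ) y * cutoff n y) +
      F (y, s) * (lap n (heatKer n (s + δ)) y * cutoff n y) with hg'
  have hder : ∀ y, ∀ s ∈ Set.uIcc 0 S, HasDerivAt
      (fun s => F (y, s) * (heatKer n (s + δ) y * cutoff n y)) (g' s y) s := by
    intro y s hs
    rw [Set.uIcc_of_le hS] at hs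
    have h1 := (hasDerivAt_heatKer (n := n) (by linarith [hs.1] : 0 < s + δ) y).comp_add_const s δ
    exact (deriv_snd_eq_fderiv dF y s).mul (h1.mul_const _)
  have hK : ContinuousOn (fun p : ℝ × EuclideanSpace ℝ (Fin n) => heatKer n (p.1 + δ) p.2)
      (Set.Icc 0 S ×ˢ Set.univ) :=
    continuousOn_heatKer.comp (f := fun p : ℝ × EuclideanSpace ℝ (Fin n) => (p.2, p.1 + δ))
      (by fun_prop) fun p hp => by
        have := hp.1.1
        simp only [Set.mem_ofPred_eq]
        linarith
  have hcont : ContinuousOn (Function.uncurry g') (Set.Icc 0 S ×ˢ Set.univ) := by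
    have hpos : ∀ p ∈ Set.Icc 0 S ×ˢ (Set.univ : Set (EuclideanSpace ℝ (Fin n))),
        p.1 + δ ≠ 0 := fun p hp => by
      have := hp.1.1
      linarith
    simp only [hg', lap_heatKer, Function.uncurry_def]
    refine ContinuousOn.add (ContinuousOn.mul ?_ (hK.mul ?_))
      (ContinuousOn.mul ?_ (ContinuousOn.mul (ContinuousOn.mul (ContinuousOn.add ?_ ?_) hK) ?_))
    · exact (cDF.comp (continuous_snd.prodMk continuous_fst)).continuousOn
    · exact (cη.comp continuous_snd).continuousOn
    · exact (cF.comp (continuous_snd.prodMk continuous_fst)).continuousOn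
    · exact (ContinuousOn.div (by fun_prop) (by fun_prop)
        fun p hp => mul_ne_zero two_ne_zero (hpos p hp)).neg
    · exact ContinuousOn.div (by fun_prop) (by fun_prop)
        fun p hp => mul_ne_zero four_ne_zero (pow_ne_zero 2 (hpos p hp))
    · exact (cη.comp continuous_snd).continuousOn
  have hint := integrable_prod_of_continuousOn (r := 1 / 2) hcont
    (fun s y hy => by simp [hg', cutoff_eq_zero hy]) hS
  have hftc y : ∫ s in 0..S, g' s y = F (y, S) * (heatKer n (S + δ) y * cutoff n y) -
      F (y, 0) * (heatKer n (0 + δ) y * cutoff n y) := by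
    refine intervalIntegral.integral_eq_sub_of_hasDerivAt (hder y) ?_
    refine ContinuousOn.intervalIntegrable ?_
    rw [Set.uIcc_of_le hS]
    exact hcont.comp (f := fun s => (s, y)) (by fun_prop) fun s hs => ⟨hs, trivial⟩
  have hsmooth s : ContDiff ℝ 2 fun y => heatKer n (s + δ) y * cutoff n y :=
    (contDiff_heatKer _).mul contDiff_cutoff
  have hcomp s : HasCompactSupport fun y => heatKer n (s + δ) y * cutoff n y :=
    hasCompactSupport_cutoff.mul_left
  have hFs s : ContDiff ℝ 2 fun y => F (y, s) := hF.comp (contDiff_id.prodMk contDiff_const)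
  have hswap := intervalIntegral_integral_swap hint
  simp only [hftc] at hswap
  rw [integral_sub] at hswap
  · rw [← hswap, ← intervalIntegral.integral_neg]
    refine intervalIntegral.integral_congr fun s hs => ?_
    rw [Set.uIcc_of_le hS] at hs
    have e1 : ∀ y, g' s y = (F (y, s) * lap n (fun y => heatKer n (s + δ) y * cutoff n y) y -
        lap n (fun y => F (y, s)) y * (heatKer n (s + δ) y * cutoff n y)) -
        F (y, s) * heatComm n (s + δ) y := fun y => by
      rw [heat y s hs.1, (deriv_snd_eq_fderiv dF y s).deriv, lap_heatKer_mul_cutoff, hg']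
      ring
    have i1 : Integrable fun y =>
        F (y, s) * lap n (fun y => heatKer n (s + δ) y * cutoff n y) y := by
      refine ((hFs s).continuous.fun_mul (hsmooth s).continuous_lap).integrable_of_hasCompactSupport ?_
      refine HasCompactSupport.intro (isCompact_closedBall 0 (1 / 2)) fun y hy => ?_
      rw [lap_heatKer_mul_cutoff, cutoff_eq_zero hy,
        heatComm_eq_zero _ (Or.inr (by simpa using hy))]
      simp
    have i2 : Integrable fun y =>
        lap n (fun y => F (y, s)) y * (heatKer n (s + δ) y * cutoff n y) :=
      ((hFs s).continuous_lap.mul (hsmooth s).continuous).integrable_of_hasCompactSupport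
        (hcomp s).mul_left
    have cK : Continuous (heatComm n (s + δ)) := by
      have h := ((hsmooth s).continuous_lap).fun_sub
        (((contDiff_heatKer (n := n) (s + δ)).continuous_lap).fun_mul cη)
      refine h.congr fun y => ?_
      rw [lap_heatKer_mul_cutoff]
      ring
    have i3 : Integrable fun y => F (y, s) * heatComm n (s + δ) y := by
      refine ((hFs s).continuous.fun_mul cK).integrable_of_hasCompactSupport ?_
      refine HasCompactSupport.intro (isCompact_closedBall 0 (1 / 2)) fun y hy => ?_
      rw [heatComm_eq_zero _ (Or.inr (by simpa using hy)), mul_zero]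
    have i12 := i1.sub i2
    simp only [Pi.sub_def] at i12
    simp only [e1]
    rw [integral_sub i12 i3, integral_sub i1 i2,
      integral_lap_mul (hFs s) (hsmooth s) (hcomp s), sub_self, zero_sub]
  · exact ((hFs S).continuous.mul (hsmooth S).continuous).integrable_of_hasCompactSupport
      (hcomp S).mul_left
  · exact ((hFs 0).continuous.mul (hsmooth 0).continuous).integrable_of_hasCompactSupport
      (hcomp 0).mul_left

lemma heatKer_inv_sq {c : ℝ} (hc : 0 < c) (y : EuclideanSpace ℝ (Fin n)) :
    heatKer n (c ^ 2)⁻¹ y = c ^ n * exp (-(1 / 4) * ‖c • y‖ ^ 2) := by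
  have h : c ^ n = exp (-(n / 2 * log (c ^ 2)⁻¹)) := by
    rw [log_inv, log_pow, ← exp_log (pow_pos hc n), log_pow]
    congr 1
    push_cast
    ring
  rw [h, ← exp_add, heatKer, norm_smul, norm_of_nonneg hc.le]
  congr 1
  field_simp
  ring

/-- The total mass of `heatKer n τ`, which does not depend on `τ`. -/
def heatMass (n : ℕ) : ℝ := ∫ z : EuclideanSpace ℝ (Fin n), exp (-(1 / 4) * ‖z‖ ^ 2)

lemma heatMass_pos : 0 < heatMass n := by
  rw [heatMass, GaussianFourier.integral_rexp_neg_mul_sq_norm (by norm_num)]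
  positivity

lemma tendsto_integral_heatKer_mul {g : EuclideanSpace ℝ (Fin n) → ℝ} (hg : Integrable g)
    (hg0 : ContinuousAt g 0) :
    Filter.Tendsto (fun c : ℝ => ∫ y, heatKer n (c ^ 2)⁻¹ y * g y) Filter.atTop
      (nhds (heatMass n * g 0)) := by
  have hZ := heatMass_pos (n := n)
  have key := tendsto_integral_comp_smul_smul_of_integrable (μ := volume)
    (φ := fun z : EuclideanSpace ℝ (Fin n) => (heatMass n)⁻¹ * exp (-(1 / 4) * ‖z‖ ^ 2))
    (fun z => by positivity) ?_ ?_ hg hg0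
  · refine (key.const_mul (heatMass n)).congr' ?_
    filter_upwards [Filter.Ioi_mem_atTop 0] with c hc
    rw [← integral_const_mul]
    congr 1 with y
    rw [heatKer_inv_sq hc, finrank_euclideanSpace_fin, smul_eq_mul]
    field_simp
  · rw [integral_const_mul]
    exact inv_mul_cancel₀ hZ.ne'
  · have A : Filter.Tendsto (fun z : EuclideanSpace ℝ (Fin n) => ‖z‖ ^ 2)
        (Bornology.cobounded _) Filter.atTop :=
      (Filter.tendsto_pow_atTop two_ne_zero).comp tendsto_norm_cobounded_atTop
    have B := ((tendsto_rpow_mul_exp_neg_mul_atTop_nhds_zero (n / 2) (1 / 4)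
      (by norm_num)).comp A).const_mul (heatMass n)⁻¹
    rw [mul_zero] at B
    refine B.congr fun z => ?_
    have : (‖z‖ ^ 2) ^ (n / 2 : ℝ) = ‖z‖ ^ n := by
      rw [← rpow_natCast, ← rpow_mul (norm_nonneg z), ← rpow_natCast]
      congr 1
      push_cast
      ring
    simp only [Function.comp_apply, this, finrank_euclideanSpace_fin]
    ring

lemma abs_integral_mul_le {f w : EuclideanSpace ℝ (Fin n) → ℝ} {M r : ℝ} (hf : Continuous f)
    (hw : ∀ y, |w y| ≤ M) (hw0 : ∀ y, y ∉ Metric.closedBall 0 r → w y = 0) :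
    |∫ y, f y * w y| ≤ M * ∫ y in Metric.closedBall 0 r, |f y| := by
  rw [← setIntegral_eq_integral_of_forall_compl_eq_zero (s := Metric.closedBall 0 r)
    fun y hy => by rw [hw0 y hy, mul_zero], ← integral_const_mul,
    ← norm_eq_abs]
  refine norm_integral_le_of_norm_le ?_ ?_
  · have : Continuous fun y => M * |f y| := continuous_const.mul hf.abs
    exact this.continuousOn.integrableOn_compact (isCompact_closedBall _ _)
  · refine .of_forall fun y => ?_
    rw [norm_eq_abs, abs_mul, mul_comm]
    exact mul_le_mul_of_nonneg_right (hw y) (abs_nonneg _)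

lemma heatKer_le_of_le {τ : ℝ} (hτ : 1 / 8 ≤ τ) (y : EuclideanSpace ℝ (Fin n)) :
    heatKer n τ y ≤ exp (n / 2 * log 8) := by
  rw [heatKer, exp_le_exp]
  have h1 : -log 8 ≤ log τ := by
    rw [← log_inv]
    exact log_le_log (by norm_num) (by linarith)
  have h2 : 0 ≤ ‖y‖ ^ 2 / (4 * τ) := by positivity
  have h3 : (n / 2 : ℝ) * -log 8 ≤ n / 2 * log τ := mul_le_mul_of_nonneg_left h1 (by positivity)
  linarith

/-- Cauchy–Schwarz against the constant function `1`. -/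
lemma sq_integral_le {α : Type*} [MeasurableSpace α] {μ : Measure α} [IsFiniteMeasure μ]
    {f : α → ℝ} (hf : Integrable f μ) (hf2 : Integrable (fun x => f x ^ 2) μ) :
    (∫ x, f x ∂μ) ^ 2 ≤ μ.real Set.univ * ∫ x, f x ^ 2 ∂μ := by
  set V := μ.real Set.univ with hV
  set I := ∫ x, f x ∂μ with hI
  rcases eq_or_lt_of_le (measureReal_nonneg (μ := μ) (s := Set.univ)) with h0 | h0
  · have : μ = 0 := by
      rw [← Measure.measure_univ_eq_zero]
      exact (measureReal_eq_zero_iff).1 h0.symm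
    simp [hI, this, hV]
  · have key : 0 ≤ ∫ x, (V * f x - I) ^ 2 ∂μ := integral_nonneg fun x => sq_nonneg _
    have e : ∀ x, (V * f x - I) ^ 2 = V ^ 2 * f x ^ 2 - 2 * V * I * f x + I ^ 2 := fun x => by ring
    have i1 : Integrable (fun x => V ^ 2 * f x ^ 2 - 2 * V * I * f x) μ :=
      (hf2.const_mul _).sub (hf.const_mul _)
    simp only [e] at key
    rw [integral_add i1 (integrable_const _), integral_sub (hf2.const_mul _) (hf.const_mul _),
      integral_const_mul, integral_const_mul, integral_const, smul_eq_mul, ← hV, ← hI] at key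
    have h0' : 0 < V := h0
    nlinarith

/-- The interior mean value inequality in `L¹` for the backward heat equation. -/
lemma exists_abs_le_integral (n : ℕ) : ∃ C : ℝ, 0 ≤ C ∧
    ∀ F : EuclideanSpace ℝ (Fin n) × ℝ → ℝ, ContDiff ℝ 2 F →
      (∀ y s, 0 ≤ s → lap n (fun y => F (y, s)) y = -deriv (fun s => F (y, s)) s) →
      |F (0, 0)| ≤ C * ∫ p in Metric.closedBall 0 (1 / 2) ×ˢ Set.Icc (0 : ℝ) (1 / 4), |F p| := by
  obtain ⟨K, hK0, hK⟩ := exists_abs_heatComm_le n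
  set A : ℝ := exp (n / 2 * log 8) with hA
  have hA0 : 0 ≤ A := (exp_pos _).le
  have hZ := heatMass_pos (n := n)
  refine ⟨8 * (A + K) / heatMass n, by positivity, fun F hF heat => ?_⟩
  have cF : Continuous F := hF.continuous
  set m : ℝ → ℝ := fun s => ∫ y in Metric.closedBall 0 (1 / 2), |F (y, s)| with hm
  have cFs s : Continuous fun y => F (y, s) := cF.comp (by fun_prop)
  have cm : Continuous m := by
    refine continuous_parametric_integral_of_continuous ?_ (isCompact_closedBall _ _)
    exact (cF.comp (continuous_snd.prodMk continuous_fst)).abs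
  have m0 s : 0 ≤ m s := integral_nonneg fun y => abs_nonneg _
  have im a b : IntervalIntegrable m volume a b := cm.intervalIntegrable a b
  set J := ∫ s in 0..(1 / 4), m s with hJ
  have sub_le a b (ha : 0 ≤ a) (hab : a ≤ b) (hb : b ≤ 1 / 4) : ∫ s in a..b, m s ≤ J :=
    intervalIntegral.integral_mono_interval ha hab hb (.of_forall m0) (im _ _)
  have bound : ∀ S ∈ Set.Icc (1 / 8 : ℝ) (1 / 4),
      heatMass n * |F (0, 0)| ≤ A * m S + K * J := by
    intro S hS
    have lim : Filter.Tendsto (fun c : ℝ => |∫ y, heatKer n (c ^ 2)⁻¹ y * (F (y, 0) * cutoff n y)|)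
        Filter.atTop (nhds (heatMass n * |F (0, 0)|)) := by
      have cη : Continuous (cutoff n) := (contDiff_cutoff (k := 0)).continuous
      have hc : Continuous fun y => F (y, 0) * cutoff n y := (cFs 0).mul cη
      have := (tendsto_integral_heatKer_mul
        (hc.integrable_of_hasCompactSupport hasCompactSupport_cutoff.mul_left) hc.continuousAt).abs
      rwa [cutoff_zero, mul_one, abs_mul, abs_of_pos hZ] at this
    refine le_of_tendsto lim ?_
    filter_upwards [Filter.Ici_mem_atTop 2] with c hc
    have hc2 : (4 : ℝ) ≤ c ^ 2 := by
      have : (2 : ℝ) ≤ c := hc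
      nlinarith
    have hδ : 0 < (c ^ 2)⁻¹ := by positivity
    have hδ1 : (c ^ 2)⁻¹ ≤ 1 / 4 := by
      rw [one_div]
      exact inv_anti₀ (by norm_num) hc2
    set δ := (c ^ 2)⁻¹
    have id := integral_heatKer_mul_cutoff_sub hF heat hδ (by linarith [hS.1] : 0 ≤ S)
    have e : ∫ y, heatKer n δ y * (F (y, 0) * cutoff n y) =
        (∫ y, F (y, S) * (heatKer n (S + δ) y * cutoff n y)) +
          ∫ s in 0..S, ∫ y, F (y, s) * heatComm n (s + δ) y := by
      have : ∀ y, heatKer n δ y * (F (y, 0) * cutoff n y) =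
        F (y, 0) * (heatKer n (0 + δ) y * cutoff n y) := fun y => by rw [zero_add]; ring
      simp only [this]
      linarith
    rw [e]
    refine (abs_add_le _ _).trans (add_le_add ?_ ?_)
    · refine abs_integral_mul_le (cFs S) (fun y => ?_) fun y hy => by
        rw [cutoff_eq_zero hy, mul_zero]
      rw [abs_of_nonneg (mul_nonneg (heatKer_pos _ _).le (cutoff_nonneg y))]
      exact (mul_le_of_le_one_right (heatKer_pos _ _).le (cutoff_le_one y)).trans
        (heatKer_le_of_le (by linarith [hS.1]) y)
    · have hS0 : 0 ≤ S := by linarith [hS.1]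
      rw [← norm_eq_abs]
      refine (intervalIntegral.norm_integral_le_of_norm_le (g := fun s => K * m s) hS0
        (.of_forall fun s hs => ?_) ((im _ _).const_mul K)).trans ?_
      · exact abs_integral_mul_le (cFs s)
          (hK (s + δ) (by linarith [hs.1]) (by linarith [hs.2, hS.2]))
          fun y hy => heatComm_eq_zero _ (Or.inr (by simpa using hy))
      · rw [intervalIntegral.integral_const_mul]
        exact mul_le_mul_of_nonneg_left (sub_le 0 S le_rfl hS0 hS.2) hK0
  have ic (c : ℝ) : IntervalIntegrable (fun _ => c) volume (1 / 8) (1 / 4) :=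
    continuous_const.intervalIntegrable _ _
  have avg := intervalIntegral.integral_mono_on (by norm_num : (1 / 8 : ℝ) ≤ 1 / 4)
    (ic (heatMass n * |F (0, 0)|)) (((im _ _).const_mul A).add (ic (K * J))) bound
  rw [intervalIntegral.integral_const, intervalIntegral.integral_add ((im _ _).const_mul A) (ic _),
    intervalIntegral.integral_const_mul, intervalIntegral.integral_const] at avg
  have h1 := mul_le_mul_of_nonneg_left
    (sub_le (1 / 8) (1 / 4) (by norm_num) (by norm_num) le_rfl) hA0
  have hJ0 : 0 ≤ J := intervalIntegral.integral_nonneg (by norm_num) fun s _ => m0 s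
  have hJQ : J = ∫ p in Metric.closedBall 0 (1 / 2) ×ˢ Set.Icc (0 : ℝ) (1 / 4), |F p| := by
    have hi : IntegrableOn (fun p : ℝ × EuclideanSpace ℝ (Fin n) => |F p.swap|)
        (Set.Icc (0 : ℝ) (1 / 4) ×ˢ Metric.closedBall 0 (1 / 2)) (volume.prod volume) :=
      ((cF.comp continuous_swap).abs.continuousOn.integrableOn_compact
        (isCompact_Icc.prod (isCompact_closedBall _ _)))
    rw [Measure.volume_eq_prod, ← setIntegral_prod_swap, setIntegral_prod _ hi, hJ,
      intervalIntegral.integral_of_le (by norm_num), integral_Icc_eq_integral_Ioc]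
    rfl
  rw [← hJQ, div_mul_eq_mul_div, le_div_iff₀ hZ]
  simp only [smul_eq_mul] at avg
  nlinarith [mul_nonneg hK0 hJ0]

/-- The interior `L²`-to-pointwise estimate for the backward heat equation. -/
lemma exists_sq_le_integral_sq (n : ℕ) : ∃ C : ℝ, 0 ≤ C ∧
    ∀ F : EuclideanSpace ℝ (Fin n) × ℝ → ℝ, ContDiff ℝ 2 F →
      (∀ y s, 0 ≤ s → lap n (fun y => F (y, s)) y = -deriv (fun s => F (y, s)) s) →
      F (0, 0) ^ 2 ≤
        C * ∫ p in Metric.closedBall 0 (1 / 2) ×ˢ Set.Icc (0 : ℝ) (1 / 4), F p ^ 2 := by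
  obtain ⟨C, hC0, hC⟩ := exists_abs_le_integral n
  set Q : Set (EuclideanSpace ℝ (Fin n) × ℝ) := Metric.closedBall 0 (1 / 2) ×ˢ Set.Icc 0 (1 / 4)
  have hQ : IsCompact Q := (isCompact_closedBall _ _).prod isCompact_Icc
  have : IsFiniteMeasure (volume.restrict Q) := ⟨by simpa using hQ.measure_lt_top⟩
  refine ⟨C ^ 2 * (volume.restrict Q).real Set.univ, by positivity, fun F hF heat => ?_⟩
  have cF := hF.continuous
  have h1 := sq_integral_le (μ := volume.restrict Q) (f := fun p => |F p|)
    (cF.abs.continuousOn.integrableOn_compact hQ)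
    ((cF.abs.pow 2).continuousOn.integrableOn_compact hQ)
  simp only [sq_abs] at h1
  calc F (0, 0) ^ 2 = |F (0, 0)| ^ 2 := (sq_abs _).symm
    _ ≤ (C * ∫ p in Q, |F p|) ^ 2 := by gcongr; exact hC F hF heat
    _ = C ^ 2 * (∫ p in Q, |F p|) ^ 2 := by ring
    _ ≤ C ^ 2 * ((volume.restrict Q).real Set.univ * ∫ p in Q, F p ^ 2) := by gcongr
    _ = _ := by ring


lemma pd_comp_add_smul {f : EuclideanSpace ℝ (Fin n) → ℝ} (hf : Differentiable ℝ f)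
    (x : EuclideanSpace ℝ (Fin n)) (ρ : ℝ) (i : Fin n) :
    pd i (fun y => f (x + ρ • y)) = fun y => ρ * pd i f (x + ρ • y) := by
  ext y
  have h : HasFDerivAt (fun y : EuclideanSpace ℝ (Fin n) => x + ρ • y)
      (ρ • ContinuousLinearMap.id ℝ (EuclideanSpace ℝ (Fin n))) y :=
    ((hasFDerivAt_id y).const_smul ρ).const_add x
  have h2 := (hf (x + ρ • y)).hasFDerivAt.comp y h
  simp only [pd]
  rw [show (fun y => f (x + ρ • y)) = f ∘ (fun y => x + ρ • y) from rfl, h2.fderiv]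
  simp

lemma lap_comp_add_smul {f : EuclideanSpace ℝ (Fin n) → ℝ} (hf : ContDiff ℝ 2 f)
    (x : EuclideanSpace ℝ (Fin n)) (ρ : ℝ) (y : EuclideanSpace ℝ (Fin n)) :
    lap n (fun y => f (x + ρ • y)) y = ρ ^ 2 * lap n f (x + ρ • y) := by
  simp only [lap_eq_sum_pd, Finset.mul_sum]
  refine Finset.sum_congr rfl fun i _ => ?_
  have h1 : Differentiable ℝ (pd i f) := (hf.pd (m := 1) (by norm_num) i).differentiable
    (by norm_num)
  have h2 : Differentiable ℝ (fun y => pd i f (x + ρ • y)) := by fun_prop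
  have h3 : pd i (fun y => ρ * pd i f (x + ρ • y)) = fun y => ρ * pd i (fun y => pd i f (x + ρ • y)) y := by
    ext y
    simp only [pd] at h2 ⊢
    rw [fderiv_const_mul (h2 y)]
    simp
  rw [pd_comp_add_smul (hf.differentiable (by norm_num)), h3, pd_comp_add_smul h1]
  ring

lemma deriv_comp_sub_mul (g : ℝ → ℝ) (t c s : ℝ) :
    deriv (fun s => g (t - c * s)) s = -(c * deriv g (t - c * s)) := by
  have h1 := deriv_comp_mul_left c (fun y => g (t - y)) s
  rw [deriv_comp_const_sub g t (c * s)] at h1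
  simpa using h1

lemma map_add_smul_volume (x : EuclideanSpace ℝ (Fin n)) {ρ : ℝ} (hρ : 0 < ρ) :
    (volume : Measure (EuclideanSpace ℝ (Fin n))).map (fun y => x + ρ • y) =
      ENNReal.ofReal (ρ ^ n)⁻¹ • volume := by
  rw [show (fun y : EuclideanSpace ℝ (Fin n) => x + ρ • y) = (fun y => x + y) ∘ (fun y => ρ • y)
    from rfl, ← Measure.map_map (by fun_prop) (by fun_prop), Measure.map_addHaar_smul _ hρ.ne',
    Measure.map_smul, map_add_left_eq_self, finrank_euclideanSpace_fin, abs_of_pos (by positivity)]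

lemma map_sub_mul_volume (t : ℝ) {c : ℝ} (hc : 0 < c) :
    (volume : Measure ℝ).map (fun s => t - c * s) = ENNReal.ofReal c⁻¹ • volume := by
  have h := Measure.map_addHaar_smul (volume : Measure ℝ) (r := -c) (by linarith)
  rw [show (fun s : ℝ => t - c * s) = (fun y => t + y) ∘ (fun y => (-c) • y) by
    ext s; simp [sub_eq_add_neg], ← Measure.map_map (by fun_prop) (by fun_prop), h,
    Measure.map_smul, map_add_left_eq_self]
  simp [abs_of_pos hc]

lemma map_parabolic_volume (x : EuclideanSpace ℝ (Fin n)) (t : ℝ) {ρ : ℝ} (hρ : 0 < ρ) :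
    (volume : Measure (EuclideanSpace ℝ (Fin n) × ℝ)).map
        (fun p => (x + ρ • p.1, t - ρ ^ 2 * p.2)) =
      ENNReal.ofReal (ρ ^ (n + 2))⁻¹ • volume := by
  have h := Measure.map_prod_map (volume : Measure (EuclideanSpace ℝ (Fin n))) (volume : Measure ℝ)
    (f := fun y => x + ρ • y) (g := fun s => t - ρ ^ 2 * s) (by fun_prop) (by fun_prop)
  rw [map_add_smul_volume x hρ, map_sub_mul_volume t (by positivity), Measure.prod_smul_left,
    Measure.prod_smul_right, smul_smul, ← ENNReal.ofReal_mul (by positivity), ← mul_inv,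
    ← pow_add] at h
  exact h.symm

lemma isCompact_Pb (r : ℝ) (x : EuclideanSpace ℝ (Fin n)) (t : ℝ) : IsCompact (Pb n r x t) := by
  have hc : IsClosed (Pb n r x t) :=
    IsClosed.inter
      (isClosed_le (f := fun p : EuclideanSpace ℝ (Fin n) × ℝ => dist p.1 x + √|t - p.2|)
        (by fun_prop) continuous_const)
      (isClosed_le continuous_snd continuous_const)
  refine ((isCompact_closedBall x r).prod (isCompact_Icc (a := t - r ^ 2) (b := t))).of_isClosed_subset
    hc fun p ⟨h1, h2⟩ => ⟨?_, ?_, h2⟩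
  · exact Metric.mem_closedBall.2 (by linarith [sqrt_nonneg |t - p.2|])
  · have h3 : √|t - p.2| ≤ r := by linarith [dist_nonneg (x := p.1) (y := x)]
    have h4 := (sqrt_le_left ((sqrt_nonneg _).trans h3)).1 h3
    linarith [le_abs_self (t - p.2)]

lemma measurableSet_Pb (r : ℝ) (x : EuclideanSpace ℝ (Fin n)) (t : ℝ) : MeasurableSet (Pb n r x t) :=
  (isCompact_Pb r x t).isClosed.measurableSet

lemma integrableOn_Pb {f : EuclideanSpace ℝ (Fin n) × ℝ → ℝ} (hf : Continuous f) (r : ℝ)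
    (x : EuclideanSpace ℝ (Fin n)) (t : ℝ) : IntegrableOn f (Pb n r x t) :=
  hf.continuousOn.integrableOn_compact (isCompact_Pb r x t)

/-- The parabolic mean value inequality for ancient solutions. -/
lemma exists_sq_le_integral_Pb (n : ℕ) : ∃ C : ℝ, 0 ≤ C ∧
    ∀ v : EuclideanSpace ℝ (Fin n) × ℝ → ℝ, IsAncientHeat n v →
    ∀ (x : EuclideanSpace ℝ (Fin n)) (t : ℝ), t ≤ 0 → ∀ ρ : ℝ, 0 < ρ →
      v (x, t) ^ 2 ≤ C * (ρ ^ (n + 2))⁻¹ * ∫ p in Pb n ρ x t, v p ^ 2 := by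
  obtain ⟨C, hC0, hC⟩ := exists_sq_le_integral_sq n
  refine ⟨C, hC0, fun v ⟨hv, heat⟩ x t ht ρ hρ => ?_⟩
  have hv2 : ContDiff ℝ 2 v := hv.of_le (WithTop.coe_le_coe.2 le_top)
  set T : EuclideanSpace ℝ (Fin n) × ℝ → EuclideanSpace ℝ (Fin n) × ℝ :=
    fun p => (x + ρ • p.1, t - ρ ^ 2 * p.2) with hT
  have cT : Continuous T := by fun_prop
  have key := hC (fun p => v (T p)) (hv2.comp (by fun_prop)) fun y s hs => by
    have h1 : ContDiff ℝ 2 fun y => v (y, t - ρ ^ 2 * s) := hv2.comp (by fun_prop)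
    have h2 := lap_comp_add_smul h1 x ρ y
    have h3 := deriv_comp_sub_mul (fun s => v (x + ρ • y, s)) t (ρ ^ 2) s
    simp only [hT]
    rw [h2, h3, heat _ _ (by nlinarith [mul_nonneg (sq_nonneg ρ) hs])]
    ring
  have hsub : Metric.closedBall 0 (1 / 2) ×ˢ Set.Icc (0 : ℝ) (1 / 4) ⊆ T ⁻¹' Pb n ρ x t := by
    rintro ⟨y, s⟩ ⟨hy, hs0, hs1⟩
    have hy' : ‖y‖ ≤ 1 / 2 := by simpa using hy
    have hs' : √(ρ ^ 2 * s) ≤ ρ / 2 := by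
      rw [sqrt_le_left (by positivity)]
      nlinarith [sq_nonneg ρ]
    have h0 : 0 ≤ ρ ^ 2 * s := mul_nonneg (sq_nonneg ρ) hs0
    refine ⟨?_, by simp only [hT]; linarith⟩
    simp only [hT, dist_self_add_left, norm_smul, norm_eq_abs, abs_of_pos hρ, sub_sub_cancel,
      abs_of_nonneg h0]
    nlinarith
  have hmap : (volume.restrict (T ⁻¹' Pb n ρ x t)).map T =
      ENNReal.ofReal (ρ ^ (n + 2))⁻¹ • volume.restrict (Pb n ρ x t) := by
    rw [← Measure.restrict_map cT.measurable (measurableSet_Pb ρ x t), map_parabolic_volume x t hρ,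
      Measure.restrict_smul]
  have hi : Integrable (fun p => v p ^ 2) ((volume.restrict (T ⁻¹' Pb n ρ x t)).map T) := by
    rw [hmap]
    exact (integrableOn_Pb (hv.continuous.pow 2) ρ x t).smul_measure ENNReal.ofReal_ne_top
  have hle : ∫ p in Metric.closedBall 0 (1 / 2) ×ˢ Set.Icc (0 : ℝ) (1 / 4), v (T p) ^ 2 ≤
      (ρ ^ (n + 2))⁻¹ * ∫ p in Pb n ρ x t, v p ^ 2 := by
    calc _ ≤ ∫ p in T ⁻¹' Pb n ρ x t, v (T p) ^ 2 :=
          setIntegral_mono_set (hi.comp_measurable cT.measurable)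
            (Filter.Eventually.of_forall fun p => sq_nonneg _) hsub.eventuallyLE
      _ = ∫ p, v p ^ 2 ∂(volume.restrict (T ⁻¹' Pb n ρ x t)).map T :=
          (integral_map cT.aemeasurable hi.aestronglyMeasurable).symm
      _ = _ := by
          rw [hmap, integral_smul_measure, ENNReal.toReal_ofReal (by positivity), smul_eq_mul]
  have h0 : T (0, 0) = (x, t) := by simp [hT]
  rw [h0] at key
  calc _ ≤ _ := key
    _ ≤ C * ((ρ ^ (n + 2))⁻¹ * ∫ p in Pb n ρ x t, v p ^ 2) := by gcongr
    _ = _ := by ring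

lemma Pb_subset_Pb {A t : ℝ} {x : EuclideanSpace ℝ (Fin n)} {p : EuclideanSpace ℝ (Fin n) × ℝ}
    (hp : p.2 ≤ t) : Pb n (A - (dist p.1 x + √|t - p.2|)) p.1 p.2 ⊆ Pb n A x t := by
  rintro ⟨y, s⟩ ⟨h1, h2⟩
  simp only at h1 h2
  refine ⟨?_, h2.trans hp⟩
  have h3 : √|t - s| ≤ √|t - p.2| + √|p.2 - s| := by
    rw [sqrt_le_left (by positivity), add_sq, sq_sqrt (abs_nonneg _), sq_sqrt (abs_nonneg _)]
    have := abs_sub_le t p.2 s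
    have : 0 ≤ 2 * √|t - p.2| * √|p.2 - s| := by positivity
    linarith
  have := dist_triangle y p.1 x
  simp only
  linarith

lemma integral_inv_sub_sqrt_pow_le (m : ℕ) {b c : ℝ} (hb : 0 ≤ b) (hbc : b < c) :
    ∫ s in (0 : ℝ)..b ^ 2, ((c - √s) ^ (m + 2))⁻¹ ≤ 2 * b / (m + 1) * ((c - b) ^ (m + 1))⁻¹ := by
  have hpos : ∀ s ∈ Set.Icc 0 (b ^ 2), 0 < c - √s ∧ √s ≤ b := fun s hs => by
    have : √s ≤ b := by rw [sqrt_le_left hb]; exact hs.2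
    exact ⟨by linarith, this⟩
  have hc : ∀ k : ℕ, ContinuousOn (fun s => ((c - √s) ^ k)⁻¹) (Set.Icc 0 (b ^ 2)) := fun k =>
    ContinuousOn.inv₀ (by fun_prop) fun s hs => (pow_pos (hpos s hs).1 k).ne'
  have h := intervalIntegral.integral_le_sub_of_hasDeriv_right_of_le (a := 0) (b := b ^ 2)
    (g := fun s => 2 * b / (m + 1) * ((c - √s) ^ (m + 1))⁻¹)
    (g' := fun s => b / √s * ((c - √s) ^ (m + 2))⁻¹)
    (φ := fun s => ((c - √s) ^ (m + 2))⁻¹) (sq_nonneg b)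
    (continuousOn_const.mul (hc (m + 1))) (fun s hs => by
      have hs' := hpos s (Set.Ioo_subset_Icc_self hs)
      have h1 := (((hasDerivAt_sqrt hs.1.ne').const_sub c).fun_pow (m + 1)).fun_inv
        (pow_pos hs'.1 _).ne'
      refine ((h1.const_mul (2 * b / (m + 1))).congr_deriv ?_).hasDerivWithinAt
      have h2 : √s ≠ 0 := (sqrt_pos.2 hs.1).ne'
      have h3 := hs'.1.ne'
      have h4 : (m : ℝ) + 1 ≠ 0 := by positivity
      push_cast
      field_simp
      ring)
    (hc (m + 2)).integrableOn_Icc (fun s hs => by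
      have hs' := hpos s (Set.Ioo_subset_Icc_self hs)
      have h2 : 0 < √s := sqrt_pos.2 hs.1
      have h3 : 1 ≤ b / √s := (one_le_div h2).2 hs'.2
      exact le_mul_of_one_le_left (inv_nonneg.2 (pow_pos hs'.1 _).le) h3)
  rw [sqrt_sq hb] at h
  have : 0 ≤ 2 * b / (m + 1) * ((c - √0) ^ (m + 1))⁻¹ := by
    have := (hpos 0 ⟨le_rfl, sq_nonneg b⟩).1
    positivity
  linarith

lemma continuousOn_inv_sub_pow {A R : ℝ} (hA : R < A) (x : EuclideanSpace ℝ (Fin n)) (t : ℝ)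
    (k : ℕ) : ContinuousOn (fun p : EuclideanSpace ℝ (Fin n) × ℝ =>
      ((A - (dist p.1 x + √|t - p.2|)) ^ k)⁻¹) (Pb n R x t) :=
  ContinuousOn.inv₀ (by fun_prop) fun p hp => (pow_pos (by linarith [hp.1]) k).ne'

lemma setIntegral_Pb_inv_le {A R : ℝ} (hR : 0 ≤ R) (hA : R < A) (x : EuclideanSpace ℝ (Fin n))
    (t : ℝ) :
    ∫ p in Pb n R x t, ((A - (dist p.1 x + √|t - p.2|)) ^ (n + 2))⁻¹ ≤
      2 * volume.real (Metric.ball (0 : EuclideanSpace ℝ (Fin n)) 1) *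
        (R / (A - R)) ^ (n + 1) := by
  set f : EuclideanSpace ℝ (Fin n) × ℝ → ℝ :=
    fun p => ((A - (dist p.1 x + √|t - p.2|)) ^ (n + 2))⁻¹ with hf
  have hi : Integrable ((Pb n R x t).indicator f) :=
    ((continuousOn_inv_sub_pow hA x t _).integrableOn_compact (isCompact_Pb R x t)).integrable_indicator
      (measurableSet_Pb R x t)
  set M : ℝ := 2 * R / (n + 1) * ((A - R) ^ (n + 1))⁻¹ with hM
  have hAR : 0 < A - R := by linarith
  have hslice : ∀ y, ∫ s, (Pb n R x t).indicator f (y, s) ≤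
      (Metric.closedBall x R).indicator (fun _ => M) y := by
    intro y
    by_cases hy : y ∈ Metric.closedBall x R
    · rw [Set.indicator_of_mem hy]
      have hd : dist y x ≤ R := hy
      set b := R - dist y x with hb
      have hb0 : 0 ≤ b := by linarith
      have hbR : b ≤ R := by linarith [dist_nonneg (x := y) (y := x)]
      have h1 : (fun s => (Pb n R x t).indicator f (y, s)) =
          (Set.Icc (t - b ^ 2) t).indicator fun s => ((A - dist y x - √(t - s)) ^ (n + 2))⁻¹ := by
        ext s
        have hiff : (y, s) ∈ Pb n R x t ↔ s ∈ Set.Icc (t - b ^ 2) t := by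
          constructor
          · rintro ⟨h1, h2⟩
            simp only at h1 h2
            have h3 : √|t - s| ≤ b := by linarith
            rw [sqrt_le_left hb0] at h3
            exact ⟨by linarith [le_abs_self (t - s)], h2⟩
          · rintro ⟨h1, h2⟩
            refine ⟨?_, h2⟩
            have h3 : √|t - s| ≤ b := by
              rw [sqrt_le_left hb0, abs_of_nonneg (by linarith)]
              linarith
            simp only
            linarith
        by_cases hs : s ∈ Set.Icc (t - b ^ 2) t
        · rw [Set.indicator_of_mem (hiff.2 hs), Set.indicator_of_mem hs]
          simp only [hf]
          rw [abs_of_nonneg (by linarith [hs.2]), sub_sub]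
        · rw [Set.indicator_of_notMem (mt hiff.1 hs), Set.indicator_of_notMem hs]
      rw [h1, integral_indicator measurableSet_Icc, integral_Icc_eq_integral_Ioc,
        ← intervalIntegral.integral_of_le (by nlinarith),
        intervalIntegral.integral_comp_sub_left (fun s => ((A - dist y x - √s) ^ (n + 2))⁻¹) t,
        sub_self, sub_sub_cancel]
      refine (integral_inv_sub_sqrt_pow_le n hb0 (by linarith)).trans ?_
      rw [show A - dist y x - b = A - R by rw [hb]; ring, hM]
      gcongr
    · rw [Set.indicator_of_notMem hy]
      have : (fun s => (Pb n R x t).indicator f (y, s)) = fun _ => 0 := by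
        ext s
        refine Set.indicator_of_notMem (fun h => hy ?_) _
        exact Metric.mem_closedBall.2 (by linarith [h.1, sqrt_nonneg |t - (y, s).2|])
      rw [this, integral_zero]
  have hball : Integrable ((Metric.closedBall x R).indicator fun _ => M) :=
    (continuousOn_const.integrableOn_compact (isCompact_closedBall x R)).integrable_indicator
      measurableSet_closedBall
  set V := volume.real (Metric.ball (0 : EuclideanSpace ℝ (Fin n)) 1) with hV
  calc ∫ p in Pb n R x t, f p = ∫ p, (Pb n R x t).indicator f p :=
        (integral_indicator (measurableSet_Pb R x t)).symm
    _ = ∫ y, ∫ s, (Pb n R x t).indicator f (y, s) := integral_prod _ hi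
    _ ≤ ∫ y, (Metric.closedBall x R).indicator (fun _ => M) y :=
        integral_mono hi.integral_prod_left hball hslice
    _ = R ^ n * V * M := by
        rw [integral_indicator measurableSet_closedBall, setIntegral_const,
          Measure.addHaar_real_closedBall _ _ hR, finrank_euclideanSpace_fin, smul_eq_mul]
    _ = 2 * V * (R / (A - R)) ^ (n + 1) / (n + 1) := by
        rw [hM, div_pow]
        field_simp
        ring
    _ ≤ _ := div_le_self (by positivity) (by simp)

lemma IsAncientHeat.sum_mul {k : ℕ} {u : Fin k → EuclideanSpace ℝ (Fin n) × ℝ → ℝ}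
    (hu : ∀ i, IsAncientHeat n (u i)) (a : Fin k → ℝ) :
    IsAncientHeat n fun p => ∑ i, a i * u i p := by
  have hs : ∀ i t, ContDiff ℝ 2 fun y => u i (y, t) := fun i t =>
    ((hu i).1.of_le (WithTop.coe_le_coe.2 le_top)).comp (by fun_prop)
  refine ⟨ContDiff.sum fun i _ => contDiff_const.mul (hu i).1, fun x t ht => ?_⟩
  have hpd : ∀ (f : Fin k → EuclideanSpace ℝ (Fin n) → ℝ), (∀ i, Differentiable ℝ (f i)) →
      ∀ j, pd j (fun y => ∑ i, a i * f i y) = fun y => ∑ i, a i * pd j (f i) y := by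
    intro f hf j
    ext y
    simp only [pd]
    rw [fderiv_fun_sum fun i _ => (hf i y).const_mul (a i)]
    simp only [FunLike.coe_sum, Finset.sum_apply]
    refine Finset.sum_congr rfl fun i _ => ?_
    rw [fderiv_const_mul (hf i y)]
    simp
  have hL : lap n (fun y => ∑ i, a i * u i (y, t)) x = ∑ i, a i * lap n (fun y => u i (y, t)) x := by
    simp only [lap_eq_sum_pd]
    simp_rw [hpd (fun i y => u i (y, t)) fun i => (hs i t).differentiable (by norm_num),
      hpd (fun i => pd _ fun y => u i (y, t)) fun i =>
        ((hs i t).pd (m := 1) (by norm_num) _).differentiable (by norm_num), Finset.mul_sum]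
    exact Finset.sum_comm
  have hD : HasDerivAt (fun s => ∑ i, a i * u i (x, s)) (∑ i, a i * deriv (fun s => u i (x, s)) t) t :=
    HasDerivAt.fun_sum fun i _ => by
      have h := deriv_snd_eq_fderiv ((hu i).1.differentiable (by norm_num)) x t
      rw [h.deriv]
      exact h.const_mul (a i)
  rw [hL, hD.deriv]
  exact Finset.sum_congr rfl fun i _ => by rw [(hu i).2 x t ht]

end Representation

lemma exists_unit_mul_eq {k : ℕ} {b : Fin k → ℝ} (hb : ∀ i, 0 ≤ b i) (h : 0 < ∑ i, b i ^ 2) :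
    ∃ a : Fin k → ℝ, (∀ i, a i ∈ Set.Icc (0 : ℝ) 1) ∧ ∑ i, a i ^ 2 = 1 ∧
      ∀ i, a i * √(∑ i, b i ^ 2) = b i := by
  have hs := sqrt_pos.2 h
  refine ⟨fun i => b i / √(∑ i, b i ^ 2), fun i => ⟨by have := hb i; positivity, ?_⟩, ?_, fun i =>
    div_mul_cancel₀ _ hs.ne'⟩
  · rw [div_le_one hs]
    exact le_sqrt_of_sq_le (Finset.single_le_sum (f := fun i => b i ^ 2)
      (fun i _ => sq_nonneg _) (Finset.mem_univ i))
  · simp only [div_pow, sq_sqrt h.le]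
    rw [← Finset.sum_div, div_self h.ne']

/-- A vector is controlled by its pairing with a unit vector with nonnegative coordinates. -/
lemma exists_nonneg_unit_sum_sq_le {k : ℕ} {w : Fin k → ℝ} (hw : 0 < ∑ i, w i ^ 2) :
    ∃ a : Fin k → ℝ, (∀ i, a i ∈ Set.Icc (0 : ℝ) 1) ∧ ∑ i, a i ^ 2 = 1 ∧
      ∑ i, w i ^ 2 ≤ 2 * (∑ i, a i * w i) ^ 2 := by
  have hsum : ∑ i, w i ^ 2 = ∑ i, (w i)⁺ ^ 2 + ∑ i, (w i)⁻ ^ 2 := by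
    rw [← Finset.sum_add_distrib]
    refine Finset.sum_congr rfl fun i _ => ?_
    rcases le_total 0 (w i) with h | h
    · simp [posPart_of_nonneg h, negPart_eq_zero.2 h]
    · simp [posPart_eq_zero.2 h, negPart_of_nonpos h]
  have key : ∀ b : Fin k → ℝ, (∀ i, 0 ≤ b i) → ∑ i, w i ^ 2 ≤ 2 * ∑ i, b i ^ 2 →
      (∑ i, b i * w i) ^ 2 = (∑ i, b i ^ 2) ^ 2 → ∃ a : Fin k → ℝ,
        (∀ i, a i ∈ Set.Icc (0 : ℝ) 1) ∧ ∑ i, a i ^ 2 = 1 ∧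
          ∑ i, w i ^ 2 ≤ 2 * (∑ i, a i * w i) ^ 2 := by
    intro b hb hle heq
    have hpos : 0 < ∑ i, b i ^ 2 := by linarith
    obtain ⟨a, ha1, ha2, ha3⟩ := exists_unit_mul_eq hb hpos
    refine ⟨a, ha1, ha2, hle.trans (le_of_eq ?_)⟩
    have h1 : ∑ i, b i * w i = √(∑ i, b i ^ 2) * ∑ i, a i * w i := by
      rw [Finset.mul_sum]
      exact Finset.sum_congr rfl fun i _ => by rw [← ha3 i]; ring
    rw [h1, mul_pow, sq_sqrt hpos.le, sq (∑ i, b i ^ 2)] at heq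
    rw [mul_left_cancel₀ hpos.ne' heq]
  rcases le_total (∑ i, (w i)⁻ ^ 2) (∑ i, (w i)⁺ ^ 2) with h | h
  · refine key (fun i => (w i)⁺) (fun i => posPart_nonneg _) (by linarith) ?_
    congr 1
    refine Finset.sum_congr rfl fun i _ => ?_
    rcases le_total 0 (w i) with h | h
    · rw [posPart_of_nonneg h, sq]
    · simp [posPart_eq_zero.2 h]
  · refine key (fun i => (w i)⁻) (fun i => negPart_nonneg _) (by linarith) ?_
    rw [← neg_sq, ← Finset.sum_neg_distrib]
    congr 1
    refine Finset.sum_congr rfl fun i _ => ?_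
    rcases le_total 0 (w i) with h | h
    · simp [negPart_eq_zero.2 h]
    · rw [negPart_of_nonpos h]
      ring

/-- basic `L²` estimate for a basis of a `k`-dimensional subspace of
`H^q(ℝⁿ × ℝ⁻)` on truncated paraboloids. -/
theorem Hq_basis_paraboloid_L2_estimate (n : ℕ) :
    ∃ C : ℝ, 0 < C ∧ ∀ q : ℝ, 1 ≤ q →
      ∀ (k : ℕ) (u : Fin k → (EuclideanSpace ℝ (Fin n) × ℝ → ℝ)),
        (∀ i, InHq n q (u i)) → LinearIndependent ℝ u →
        ∀ (x₀ : EuclideanSpace ℝ (Fin n)) (t₀ : ℝ), t₀ ≤ 0 →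
        ∀ R : ℝ, 1 ≤ R → ∀ ε : ℝ, ε ∈ Set.Ioc (0 : ℝ) 1 →
        ∑ i, ∫ p in Pb n R x₀ t₀, (u i p) ^ 2 ≤
          C * ε ^ (-((n : ℤ) + 1)) *
            sSup {I : ℝ | ∃ a : Fin k → ℝ, (∀ i, a i ∈ Set.Icc (0 : ℝ) 1) ∧
              (∑ i, (a i) ^ 2) = 1 ∧
              I = ∫ p in Pb n ((1 + ε) * R) x₀ t₀, (∑ i, a i * u i p) ^ 2} := by
  obtain ⟨C, hC0, hC⟩ := exists_sq_le_integral_Pb n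
  set V := volume.real (Metric.ball (0 : EuclideanSpace ℝ (Fin n)) 1) with hV
  refine ⟨2 * C * (2 * V) + 1, by positivity, fun q _ k u hu _ x₀ t₀ ht₀ R hR ε hε => ?_⟩
  set S := {I : ℝ | ∃ a : Fin k → ℝ, (∀ i, a i ∈ Set.Icc (0 : ℝ) 1) ∧ (∑ i, (a i) ^ 2) = 1 ∧
    I = ∫ p in Pb n ((1 + ε) * R) x₀ t₀, (∑ i, a i * u i p) ^ 2} with hS
  have hε0 : 0 < ε := hε.1
  have hAR : R < (1 + ε) * R := by nlinarith
  have cu : ∀ i, Continuous (u i) := fun i => (hu i).1.1.continuous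
  have hS0 : 0 ≤ sSup S := by
    refine Real.sSup_nonneg ?_
    rintro _ ⟨a, -, -, rfl⟩
    exact integral_nonneg fun p => sq_nonneg _
  have hbdd : BddAbove S := by
    refine ⟨∫ p in Pb n ((1 + ε) * R) x₀ t₀, ∑ i, u i p ^ 2, ?_⟩
    rintro _ ⟨a, -, ha, rfl⟩
    refine setIntegral_mono (integrableOn_Pb (by fun_prop) _ _ _)
      (integrableOn_Pb (by fun_prop) _ _ _) fun p => ?_
    have := Finset.sum_mul_sq_le_sq_mul_sq Finset.univ a fun i => u i p
    rwa [ha, one_mul] at this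
  have hpt : ∀ p ∈ Pb n R x₀ t₀, ∑ i, u i p ^ 2 ≤ 2 * C * sSup S *
      (((1 + ε) * R - (dist p.1 x₀ + √|t₀ - p.2|)) ^ (n + 2))⁻¹ := by
    intro p hp
    have hρ : 0 < (1 + ε) * R - (dist p.1 x₀ + √|t₀ - p.2|) := by linarith [hp.1]
    rcases (Finset.sum_nonneg fun i _ => sq_nonneg (u i p) :
      0 ≤ ∑ i, u i p ^ 2).eq_or_lt with h0 | hpos
    · rw [← h0]
      positivity
    obtain ⟨a, ha1, ha2, ha3⟩ := exists_nonneg_unit_sum_sq_le hpos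
    have hv := IsAncientHeat.sum_mul (fun i => (hu i).1) a
    have hmean := hC _ hv p.1 p.2 (hp.2.trans ht₀) _ hρ
    have hint : ∫ z in Pb n ((1 + ε) * R - (dist p.1 x₀ + √|t₀ - p.2|)) p.1 p.2,
        (∑ i, a i * u i z) ^ 2 ≤ sSup S :=
      (setIntegral_mono_set (integrableOn_Pb (by fun_prop) _ _ _)
        (Filter.Eventually.of_forall fun z => sq_nonneg _)
        (Pb_subset_Pb hp.2).eventuallyLE).trans (le_csSup hbdd ⟨a, ha1, ha2, rfl⟩)
    calc ∑ i, u i p ^ 2 ≤ 2 * (∑ i, a i * u i p) ^ 2 := ha3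
      _ ≤ 2 * (C * (((1 + ε) * R - (dist p.1 x₀ + √|t₀ - p.2|)) ^ (n + 2))⁻¹ * sSup S) := by
          refine mul_le_mul_of_nonneg_left (hmean.trans ?_) zero_le_two
          gcongr
      _ = _ := by ring
  have hε' : ε ^ (-((n : ℤ) + 1)) = (R / ((1 + ε) * R - R)) ^ (n + 1) := by
    rw [show (1 + ε) * R - R = ε * R by ring, div_mul_cancel_right₀ (by linarith), inv_pow,
      zpow_neg]
    norm_cast
  calc ∑ i, ∫ p in Pb n R x₀ t₀, u i p ^ 2 = ∫ p in Pb n R x₀ t₀, ∑ i, u i p ^ 2 :=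
        (integral_finsetSum _ fun i _ => integrableOn_Pb ((cu i).pow 2) _ _ _).symm
    _ ≤ ∫ p in Pb n R x₀ t₀, 2 * C * sSup S *
          (((1 + ε) * R - (dist p.1 x₀ + √|t₀ - p.2|)) ^ (n + 2))⁻¹ :=
        setIntegral_mono_on (integrableOn_Pb (by fun_prop) _ _ _)
          ((continuousOn_const.mul (continuousOn_inv_sub_pow hAR x₀ t₀ _)).integrableOn_compact
            (isCompact_Pb _ _ _)) (measurableSet_Pb _ _ _) hpt
    _ ≤ 2 * C * sSup S * (2 * V * (R / ((1 + ε) * R - R)) ^ (n + 1)) := by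
        rw [integral_const_mul]
        exact mul_le_mul_of_nonneg_left (setIntegral_Pb_inv_le (by linarith) hAR x₀ t₀)
          (by positivity)
    _ = 2 * C * (2 * V) * ε ^ (-((n : ℤ) + 1)) * sSup S := by rw [hε']; ring
    _ ≤ _ := by gcongr; linarith
end
end

section
/- Let K be a finite-dimensional subspace of the space H^q(ℝⁿ × ℝ⁻) of ancient solutions of the heat equation on ℝⁿ of polynomial growth of degree at most q. Then there exists R₀ = R₀(K) > 0 such that for all R ≥ R₀ and all (x₀,t₀) ∈ ℝⁿ × (-∞,0], the bilinear form (u,v) ↦ ∫_{P_R(x₀,t₀)} u v dx dt is an inner product on K; in particular, if u ∈ K and ∫_{P_R(x₀,t₀)} u² dx dt = 0 then u = 0. -/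
open MeasureTheory Real

noncomputable section

/-- Derivative of `u` in the direction `w`. -/
def dirDeriv {F : Type*} [NormedAddCommGroup F] [NormedSpace ℝ F] (w : F) (u : F → ℝ) (p : F) : ℝ :=
  fderiv ℝ u p w

section DirDeriv

variable {F : Type*} [NormedAddCommGroup F] [NormedSpace ℝ F]

lemma contDiff_dirDeriv (w : F) {u : F → ℝ} (hu : ContDiff ℝ (⊤ : ℕ∞) u) :
    ContDiff ℝ (⊤ : ℕ∞) (dirDeriv w u) :=
  (hu.fderiv_right (m := (⊤ : ℕ∞)) (by simp)).clm_apply contDiff_const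

lemma dirDeriv_comm (w w' : F) {u : F → ℝ} (hu : ContDiff ℝ (⊤ : ℕ∞) u) (p : F) :
    dirDeriv w (dirDeriv w' u) p = dirDeriv w' (dirDeriv w u) p := by
  have hd : DifferentiableAt ℝ (fderiv ℝ u) p :=
    ((hu.fderiv_right (m := (⊤ : ℕ∞)) (by simp)).differentiable (by simp)) p
  have key : ∀ a b : F, dirDeriv a (dirDeriv b u) p = fderiv ℝ (fderiv ℝ u) p a b := by
    intro a b
    have := (hd.hasFDerivAt.clm_apply (hasFDerivAt_const b p)).fderiv
    unfold dirDeriv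
    rw [this]
    simp
  rw [key, key]
  exact (hu.contDiffAt.isSymmSndFDerivAt
    (by simpa using WithTop.coe_le_coe.2 (le_top (a := (2 : ℕ∞))))).eq w w'

lemma hasDerivAt_line (w : F) {u : F → ℝ} (hu : ContDiff ℝ (⊤ : ℕ∞) u) (p : F) (s : ℝ) :
    HasDerivAt (fun s : ℝ => u (p + s • w)) (dirDeriv w u (p + s • w)) s := by
  have h1 : HasDerivAt (fun s : ℝ => p + s • w) w s := by
    simpa using ((hasDerivAt_id s).smul_const w).const_add p
  exact ((hu.differentiable (by simp)) (p + s • w)).hasFDerivAt.comp_hasDerivAt s h1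

end DirDeriv

lemma second_deriv_nonpos_of_isLocalMax {f f' : ℝ → ℝ} {c : ℝ}
    (hf : ∀ s, HasDerivAt f (f' s) s) (hf' : HasDerivAt f' c 0) (hmax : IsLocalMax f 0) :
    c ≤ 0 := by
  by_contra! hc
  have hd : deriv f = f' := funext fun s => (hf s).deriv
  have h0 : deriv f 0 = 0 := hmax.deriv_eq_zero
  have hmin : IsLocalMin f 0 :=
    isLocalMin_of_deriv_deriv_pos (by rw [hd, hf'.deriv]; exact hc) h0 (hf 0).continuousAt
  have hconst : f =ᶠ[nhds 0] fun _ => f 0 := by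
    filter_upwards [hmax, hmin] with s h1 h2 using le_antisymm h1 h2
  have h2 : deriv f =ᶠ[nhds 0] deriv (fun _ => f 0) := hconst.deriv
  have h3 := h2.deriv_eq
  rw [hd, hf'.deriv] at h3
  simp at h3
  exact hc.ne' h3

lemma deriv_nonneg_of_left_max {f : ℝ → ℝ} {c : ℝ} (hf : HasDerivAt f c 0)
    (hmax : ∀ᶠ s in nhdsWithin 0 (Set.Iio 0), f s ≤ f 0) : 0 ≤ c := by
  have h := hasDerivWithinAt_iff_tendsto_slope' (s := Set.Iio (0 : ℝ)) (by simp) |>.1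
    (hf.hasDerivWithinAt (s := Set.Iio 0))
  refine ge_of_tendsto h ?_
  filter_upwards [hmax, self_mem_nhdsWithin] with s hs hs0
  rw [slope_def_field]
  have : s < 0 := hs0
  exact div_nonneg_of_nonpos (by linarith) (by linarith)

/-- The `i`-th spatial coordinate direction in space-time. -/
def spaceDir {n : ℕ} (i : Fin n) : EuclideanSpace ℝ (Fin n) × ℝ := (EuclideanSpace.single i 1, 0)

/-- The time direction in space-time. -/
def timeDir (n : ℕ) : EuclideanSpace ℝ (Fin n) × ℝ := (0, 1)

/-- The heat equation on `t ≤ 0`, in terms of directional derivatives in space-time. -/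
def IsCaloric {n : ℕ} (u : EuclideanSpace ℝ (Fin n) × ℝ → ℝ) : Prop :=
  ContDiff ℝ (⊤ : ℕ∞) u ∧ ∀ p : EuclideanSpace ℝ (Fin n) × ℝ, p.2 ≤ 0 →
    ∑ i, dirDeriv (spaceDir i) (dirDeriv (spaceDir i) u) p = dirDeriv (timeDir n) u p

lemma fderiv_slice_space {n : ℕ} {u : EuclideanSpace ℝ (Fin n) × ℝ → ℝ}
    (hu : ContDiff ℝ (⊤ : ℕ∞) u) (x : EuclideanSpace ℝ (Fin n)) (t : ℝ) (i : Fin n) :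
    fderiv ℝ (fun y => u (y, t)) x (EuclideanSpace.single i 1) =
      dirDeriv (spaceDir i) u (x, t) := by
  have h1 : HasFDerivAt (fun y : EuclideanSpace ℝ (Fin n) => (y, t))
      (ContinuousLinearMap.inl ℝ (EuclideanSpace ℝ (Fin n)) ℝ) x := hasFDerivAt_prodMk_left x t
  have h2 := (((hu.differentiable (by simp)) (x, t)).hasFDerivAt.comp x h1).fderiv
  simp only [Function.comp_def] at h2
  rw [h2]
  rfl

lemma IsAncientHeat.isCaloric {n : ℕ} {u : EuclideanSpace ℝ (Fin n) × ℝ → ℝ}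
    (hu : IsAncientHeat n u) : IsCaloric u := by
  refine ⟨hu.1, fun ⟨x, t⟩ ht => ?_⟩
  have h := hu.2 x t ht
  have h1 : HasDerivAt (fun s : ℝ => u (x, s)) (dirDeriv (timeDir n) u (x, t)) t := by
    have h1 : HasFDerivAt (fun s : ℝ => (x, s))
      (ContinuousLinearMap.inr ℝ (EuclideanSpace ℝ (Fin n)) ℝ) t := hasFDerivAt_prodMk_right x t
    exact (((hu.1.differentiable (by simp)) (x, t)).hasFDerivAt.comp t h1).hasDerivAt
  rw [h1.deriv] at h
  rw [← h, lap]
  refine Finset.sum_congr rfl fun i _ => ?_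
  simp only [fderiv_slice_space hu.1]
  rw [fderiv_slice_space (contDiff_dirDeriv _ hu.1)]

lemma IsCaloric.dirDeriv_spaceDir {n : ℕ} {u : EuclideanSpace ℝ (Fin n) × ℝ → ℝ}
    (hu : IsCaloric u) (j : Fin n) : IsCaloric (dirDeriv (spaceDir j) u) := by
  refine ⟨contDiff_dirDeriv _ hu.1, fun p hp => ?_⟩
  have hc : ∀ i, dirDeriv (spaceDir i) (dirDeriv (spaceDir i) (dirDeriv (spaceDir j) u)) p =
      dirDeriv (spaceDir j) (dirDeriv (spaceDir i) (dirDeriv (spaceDir i) u)) p := by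
    intro i
    have : dirDeriv (spaceDir i) (dirDeriv (spaceDir j) u) =
        dirDeriv (spaceDir j) (dirDeriv (spaceDir i) u) :=
      funext fun p => dirDeriv_comm _ _ hu.1 p
    rw [this, dirDeriv_comm _ _ (contDiff_dirDeriv _ hu.1)]
  rw [Finset.sum_congr rfl fun i _ => hc i, dirDeriv_comm (timeDir n) _ hu.1]
  have hline : ∀ s : ℝ, (p + s • spaceDir j).2 = p.2 := by simp [spaceDir]
  have h1 : HasDerivAt (fun s : ℝ => ∑ i, dirDeriv (spaceDir i) (dirDeriv (spaceDir i) u)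
      (p + s • spaceDir j)) (∑ i, dirDeriv (spaceDir j)
        (dirDeriv (spaceDir i) (dirDeriv (spaceDir i) u)) (p + (0 : ℝ) • spaceDir j)) 0 :=
    HasDerivAt.fun_sum fun i _ =>
      hasDerivAt_line _ (contDiff_dirDeriv _ (contDiff_dirDeriv _ hu.1)) p 0
  have h2 := hasDerivAt_line (spaceDir j) (contDiff_dirDeriv (timeDir n) hu.1) p 0
  have he : (fun s : ℝ => ∑ i, dirDeriv (spaceDir i) (dirDeriv (spaceDir i) u)
      (p + s • spaceDir j)) = fun s => dirDeriv (timeDir n) u (p + s • spaceDir j) :=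
    funext fun s => hu.2 _ (by rw [hline]; exact hp)
  rw [he] at h1
  simpa using h1.unique h2

/-- Bernstein's computation: at an interior maximum of `η² v² + A u² - ε t`, with `v = ∂_j u`,
the weight `A` cannot dominate the derivatives of `η = R² - |x - x₀|² + (t - t₀)`. -/
lemma IsCaloric.false_of_interior_max {n : ℕ} {u : EuclideanSpace ℝ (Fin n) × ℝ → ℝ}
    (hu : IsCaloric u) (j : Fin n) {R ε t₀ : ℝ} (hε : 0 < ε) (ht₀ : t₀ ≤ 0)
    (x₀ : EuclideanSpace ℝ (Fin n)) {η : EuclideanSpace ℝ (Fin n) × ℝ → ℝ}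
    (hη : ∀ p, η p = R ^ 2 - ‖p.1 - x₀‖ ^ 2 + (p.2 - t₀))
    {p : EuclideanSpace ℝ (Fin n) × ℝ} (hp : 0 < η p) (hpt : p.2 ≤ t₀)
    (hmax : ∀ p' : EuclideanSpace ℝ (Fin n) × ℝ, 0 ≤ η p' → p'.2 ≤ t₀ →
      (η p' * dirDeriv (spaceDir j) u p') ^ 2 + (13 + 2 * n) * R ^ 2 * u p' ^ 2
        - ε * (p'.2 - t₀) ≤
      (η p * dirDeriv (spaceDir j) u p) ^ 2 + (13 + 2 * n) * R ^ 2 * u p ^ 2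
        - ε * (p.2 - t₀)) : False := by
  set A : ℝ := (13 + 2 * n) * R ^ 2 with hA
  set v := dirDeriv (spaceDir j) u with hv
  have hvc : IsCaloric v := hu.dirDeriv_spaceDir j
  have hηcont : Continuous η := by
    rw [funext hη]; fun_prop
  have hηspace : ∀ i (s : ℝ), η (p + s • spaceDir i) = η p - 2 * s * (p.1 - x₀) i - s ^ 2 := by
    intro i s
    have h1 : (p + s • spaceDir i).1 - x₀ = (p.1 - x₀) + s • EuclideanSpace.single i (1 : ℝ) := by
      simp only [spaceDir, Prod.fst_add, Prod.smul_fst]; abel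
    rw [hη, hη, h1, norm_add_sq_real, inner_smul_right, EuclideanSpace.inner_single_right,
      norm_smul]
    simp [spaceDir]
    ring
  have hηtime : ∀ s : ℝ, η (p + s • timeDir n) = η p + s := by
    intro s
    rw [hη, hη]
    simp [timeDir]
    ring
  have hspace : ∀ i, 2 * (-2 * (p.1 - x₀) i) ^ 2 * v p ^ 2 - 4 * η p * v p ^ 2
      + 8 * η p * (-2 * (p.1 - x₀) i) * v p * dirDeriv (spaceDir i) v p
      + 2 * η p ^ 2 * dirDeriv (spaceDir i) v p ^ 2
      + 2 * η p ^ 2 * v p * dirDeriv (spaceDir i) (dirDeriv (spaceDir i) v) p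
      + 2 * A * dirDeriv (spaceDir i) u p ^ 2
      + 2 * A * u p * dirDeriv (spaceDir i) (dirDeriv (spaceDir i) u) p ≤ 0 := by
    intro i
    set b := (p.1 - x₀) i
    set e : EuclideanSpace ℝ (Fin n) × ℝ := spaceDir i
    have hh : ∀ s : ℝ, HasDerivAt (fun s : ℝ => η p - 2 * s * b - s ^ 2) (-2 * b - 2 * s) s := by
      intro s
      have := (((hasDerivAt_id' s).const_mul 2).mul_const b |>.const_sub (η p)).fun_sub
        ((hasDerivAt_id' s).fun_pow 2)
      simpa using this
    have hh' : HasDerivAt (fun s : ℝ => -2 * b - 2 * s) (-2) 0 := by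
      simpa using ((hasDerivAt_id (0 : ℝ)).const_mul 2).const_sub (-2 * b)
    have hg := hasDerivAt_line e hvc.1 p
    have hg' := hasDerivAt_line e (contDiff_dirDeriv e hvc.1) p 0
    have hf := hasDerivAt_line e hu.1 p
    have hf' := hasDerivAt_line e (contDiff_dirDeriv e hu.1) p 0
    have d1 : ∀ s, HasDerivAt (fun s : ℝ => ((η p - 2 * s * b - s ^ 2) * v (p + s • e)) ^ 2
        + A * u (p + s • e) ^ 2 - ε * (p.2 - t₀))
        (2 * ((η p - 2 * s * b - s ^ 2) * v (p + s • e)) * ((-2 * b - 2 * s) * v (p + s • e)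
          + (η p - 2 * s * b - s ^ 2) * dirDeriv e v (p + s • e))
          + A * (2 * u (p + s • e) * dirDeriv e u (p + s • e))) s := by
      intro s
      have := ((((hh s).fun_mul (hg s)).fun_pow 2).fun_add
        (((hf s).fun_pow 2).const_mul A)).sub_const (ε * (p.2 - t₀))
      simpa using this
    have d2 := ((((hh 0).fun_mul (hg 0)).const_mul 2).fun_mul
      ((hh'.fun_mul (hg 0)).fun_add ((hh 0).fun_mul hg'))).fun_add
      ((((hf 0).const_mul 2).fun_mul hf').const_mul A)
    have hloc : IsLocalMax (fun s : ℝ => ((η p - 2 * s * b - s ^ 2) * v (p + s • e)) ^ 2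
        + A * u (p + s • e) ^ 2 - ε * (p.2 - t₀)) 0 := by
      have hpos : ∀ᶠ s : ℝ in nhds 0, 0 < η p - 2 * s * b - s ^ 2 := by
        refine Filter.Tendsto.eventually_const_lt (u := 0) (v := η p) hp ?_
        have : Continuous fun s : ℝ => η p - 2 * s * b - s ^ 2 := by fun_prop
        simpa using this.tendsto 0
      filter_upwards [hpos] with s hs
      have h2 : (p + s • e).2 = p.2 := by simp [e, spaceDir]
      have := hmax (p + s • e) (by rw [hηspace]; exact hs.le) (by rw [h2]; exact hpt)
      rw [hηspace, h2] at this
      simpa only [zero_smul, add_zero, mul_zero, zero_mul, sub_zero, ne_eq, OfNat.ofNat_ne_zero,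
        not_false_eq_true, zero_pow] using this
    have := second_deriv_nonpos_of_isLocalMax d1 d2 hloc
    simp only [zero_smul, add_zero, mul_zero, zero_mul, sub_zero, ne_eq, OfNat.ofNat_ne_zero,
      not_false_eq_true, zero_pow] at this
    linarith
  have htime : 0 ≤ 2 * η p * v p ^ 2 + 2 * η p ^ 2 * v p * dirDeriv (timeDir n) v p
      + 2 * A * u p * dirDeriv (timeDir n) u p - ε := by
    have hh : HasDerivAt (fun s : ℝ => η p + s) 1 0 := (hasDerivAt_id (0 : ℝ)).const_add _
    have hg := hasDerivAt_line (timeDir n) hvc.1 p 0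
    have hf := hasDerivAt_line (timeDir n) hu.1 p 0
    have d : HasDerivAt (fun s : ℝ => ((η p + s) * v (p + s • timeDir n)) ^ 2
        + A * u (p + s • timeDir n) ^ 2 - ε * (p.2 + s - t₀))
        (2 * η p * v p ^ 2 + 2 * η p ^ 2 * v p * dirDeriv (timeDir n) v p
          + 2 * A * u p * dirDeriv (timeDir n) u p - ε) 0 := by
      have h3 : HasDerivAt (fun s : ℝ => ε * (p.2 + s - t₀)) ε 0 := by
        simpa using (((hasDerivAt_id (0 : ℝ)).const_add p.2).sub_const t₀).const_mul ε
      have := (((hh.fun_mul hg).fun_pow 2).fun_add ((hf.fun_pow 2).const_mul A)).fun_sub h3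
      refine this.congr_deriv ?_
      simp only [zero_smul, add_zero]
      ring
    refine deriv_nonneg_of_left_max d ?_
    have hpos : ∀ᶠ s : ℝ in nhdsWithin 0 (Set.Iio 0), 0 < η p + s := by
      refine nhdsWithin_le_nhds (Filter.Tendsto.eventually_const_lt (u := 0) (v := η p) hp ?_)
      have : Continuous fun s : ℝ => η p + s := by fun_prop
      simpa using this.tendsto 0
    filter_upwards [hpos, self_mem_nhdsWithin] with s hs hs0
    have hs0' : s < 0 := hs0
    have h2 : (p + s • timeDir n).2 = p.2 + s := by simp [timeDir]
    have := hmax (p + s • timeDir n) (by rw [hηtime]; exact hs.le) (by rw [h2]; linarith)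
    rw [hηtime, h2] at this
    simpa using this
  have hp0 : p.2 ≤ 0 := hpt.trans ht₀
  have hnorm : ∑ i, (p.1 - x₀) i ^ 2 = ‖p.1 - x₀‖ ^ 2 := by
    rw [EuclideanSpace.norm_sq_eq]; simp
  have hgrad : v p ^ 2 ≤ ∑ i, dirDeriv (spaceDir i) u p ^ 2 :=
    Finset.single_le_sum (f := fun i => dirDeriv (spaceDir i) u p ^ 2)
      (fun i _ => sq_nonneg _) (Finset.mem_univ j)
  have hsum : ∑ i : Fin n, (-24 * (p.1 - x₀) i ^ 2 * v p ^ 2 - 4 * η p * v p ^ 2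
      + 2 * η p ^ 2 * v p * dirDeriv (spaceDir i) (dirDeriv (spaceDir i) v) p
      + 2 * A * dirDeriv (spaceDir i) u p ^ 2
      + 2 * A * u p * dirDeriv (spaceDir i) (dirDeriv (spaceDir i) u) p) ≤ 0 := by
    refine Finset.sum_nonpos fun i _ => ?_
    nlinarith [hspace i, sq_nonneg (2 * (-2 * (p.1 - x₀) i) * v p
      + η p * dirDeriv (spaceDir i) v p)]
  simp only [Finset.sum_add_distrib, Finset.sum_sub_distrib, ← Finset.mul_sum, ← Finset.sum_mul,
    hu.2 p hp0, hvc.2 p hp0, hnorm, Finset.sum_const, Finset.card_univ, Fintype.card_fin,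
    nsmul_eq_mul] at hsum
  have hA0 : 0 ≤ A := by positivity
  have h1 := mul_le_mul_of_nonneg_left hgrad hA0
  have hηp := hη p
  have h2 : (2 + 4 * n) * η p + 24 * ‖p.1 - x₀‖ ^ 2 ≤ 2 * A := by
    have : η p ≤ R ^ 2 := by nlinarith [sq_nonneg ‖p.1 - x₀‖]
    have h3 : ‖p.1 - x₀‖ ^ 2 ≤ R ^ 2 := by linarith
    have h4 : (2 + 4 * (n : ℝ)) * η p ≤ (2 + 4 * n) * R ^ 2 := by gcongr
    rw [hA]; linarith
  have h3 := mul_le_mul_of_nonneg_right h2 (sq_nonneg (v p))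
  linarith

/-- Interior gradient estimate on a parabolic cylinder. -/
lemma IsCaloric.gradient_estimate {n : ℕ} {u : EuclideanSpace ℝ (Fin n) × ℝ → ℝ}
    (hu : IsCaloric u) (j : Fin n) {R t₀ M : ℝ} (hR : 0 < R) (ht₀ : t₀ ≤ 0)
    (x₀ : EuclideanSpace ℝ (Fin n))
    (hM : ∀ p : EuclideanSpace ℝ (Fin n) × ℝ, ‖p.1 - x₀‖ ≤ R → t₀ - R ^ 2 ≤ p.2 → p.2 ≤ t₀ →
      |u p| ≤ M) :
    (R * dirDeriv (spaceDir j) u (x₀, t₀)) ^ 2 ≤ (13 + 2 * n) * M ^ 2 := by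
  set v := dirDeriv (spaceDir j) u with hv
  let η : EuclideanSpace ℝ (Fin n) × ℝ → ℝ := fun p => R ^ 2 - ‖p.1 - x₀‖ ^ 2 + (p.2 - t₀)
  have hηcont : Continuous η := by fun_prop
  have hvcont : Continuous v := (contDiff_dirDeriv _ hu.1).continuous
  have hucont : Continuous u := hu.1.continuous
  let S : Set (EuclideanSpace ℝ (Fin n) × ℝ) := {p | 0 ≤ η p ∧ p.2 ≤ t₀}
  have hSbd : ∀ p ∈ S, ‖p.1 - x₀‖ ≤ R ∧ t₀ - R ^ 2 ≤ p.2 ∧ p.2 ≤ t₀ := by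
    rintro p ⟨h1, h2⟩
    simp only [η] at h1
    exact ⟨abs_le_of_sq_le_sq' (by linarith) hR.le |>.2, by nlinarith [sq_nonneg ‖p.1 - x₀‖], h2⟩
  have hScompact : IsCompact S := by
    refine ((isCompact_closedBall x₀ R).prod (isCompact_Icc (a := t₀ - R ^ 2) (b := t₀))
      ).of_isClosed_subset ?_ ?_
    · exact (isClosed_le continuous_const hηcont).inter (isClosed_le continuous_snd continuous_const)
    · intro p hp
      obtain ⟨h1, h2, h3⟩ := hSbd p hp
      exact ⟨by rwa [mem_closedBall_iff_norm], h2, h3⟩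
  have h0S : (x₀, t₀) ∈ S := by simp [S, η]; positivity
  have key : ∀ ε > 0, R ^ 2 * (R * v (x₀, t₀)) ^ 2 ≤ (13 + 2 * n) * R ^ 2 * M ^ 2 + R ^ 2 * ε := by
    intro ε hε
    obtain ⟨p, hpS, hpmax⟩ := hScompact.exists_isMaxOn ⟨_, h0S⟩ (f := fun p' =>
      (η p' * v p') ^ 2 + (13 + 2 * n) * R ^ 2 * u p' ^ 2 - ε * (p'.2 - t₀))
      (by fun_prop)
    have hη0 : η p = 0 := by
      by_contra hne
      exact hu.false_of_interior_max j hε ht₀ x₀ (η := η) (fun _ => rfl)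
        (lt_of_le_of_ne hpS.1 (Ne.symm hne)) hpS.2 (fun p' h1 h2 => hpmax ⟨h1, h2⟩)
    have h1 := isMaxOn_iff.1 hpmax _ h0S
    obtain ⟨h2, h3, h4⟩ := hSbd p hpS
    have h5 : u p ^ 2 ≤ M ^ 2 := sq_le_sq' (by linarith [neg_abs_le (u p), hM p h2 h3 h4])
      ((le_abs_self _).trans (hM p h2 h3 h4))
    have h6 : (13 + 2 * (n : ℝ)) * R ^ 2 * u p ^ 2 ≤ (13 + 2 * n) * R ^ 2 * M ^ 2 := by gcongr
    have h7 : 0 ≤ (13 + 2 * (n : ℝ)) * R ^ 2 * u (x₀, t₀) ^ 2 := by positivity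
    have h8 : η (x₀, t₀) = R ^ 2 := by simp [η]
    simp only [hη0, h8, sub_self, mul_zero] at h1
    nlinarith
  have hR2 : 0 < R ^ 2 := by positivity
  refine le_of_forall_pos_le_add fun ε hε => ?_
  have := key ε hε
  refine le_of_mul_le_mul_left ?_ hR2
  linarith

lemma IsCaloric.growth_dirDeriv {n : ℕ} {u : EuclideanSpace ℝ (Fin n) × ℝ → ℝ}
    (hu : IsCaloric u) (j : Fin n) {k : ℕ} {c : ℝ}
    (hc : ∀ p : EuclideanSpace ℝ (Fin n) × ℝ, p.2 ≤ 0 →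
      |u p| ≤ c * (‖p.1‖ + √|p.2| + 1) ^ k)
    {p : EuclideanSpace ℝ (Fin n) × ℝ} (hp : p.2 ≤ 0) {R : ℝ}
    (hR : ‖p.1‖ + √|p.2| + 1 ≤ R) :
    R * |dirDeriv (spaceDir j) u p| ≤ √(13 + 2 * n) * (c * (3 * R) ^ k) := by
  have hc0 : 0 ≤ c := by
    have := (abs_nonneg _).trans (hc (0, 0) le_rfl)
    simpa using this
  have hR0 : 0 < R := lt_of_lt_of_le (by positivity) hR
  have h := hu.gradient_estimate j hR0 hp p.1 (M := c * (3 * R) ^ k) ?_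
  · have h2 := Real.sqrt_le_sqrt h
    rw [Real.sqrt_sq_eq_abs, Real.sqrt_mul (by positivity), Real.sqrt_sq (by positivity),
      abs_mul, abs_of_pos hR0] at h2
    exact h2
  · intro p' h1 h2 h3
    refine (hc p' (h3.trans hp)).trans ?_
    have h4 : ‖p'.1‖ ≤ ‖p.1‖ + R := by
      calc ‖p'.1‖ = ‖p.1 + (p'.1 - p.1)‖ := by congr 1; abel
        _ ≤ _ := (norm_add_le _ _).trans (by linarith)
    have h5 : √|p'.2| ≤ √|p.2| + R := by
      refine Real.sqrt_le_iff.2 ⟨by positivity, ?_⟩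
      rw [abs_of_nonpos (h3.trans hp)]
      have h6 : √|p.2| ^ 2 = -p.2 := by rw [Real.sq_sqrt (abs_nonneg _), abs_of_nonpos hp]
      nlinarith [mul_nonneg (Real.sqrt_nonneg |p.2|) hR0.le]
    gcongr
    linarith

lemma IsCaloric.eq_zero_of_dirDeriv_eq_zero {n : ℕ} {u : EuclideanSpace ℝ (Fin n) × ℝ → ℝ}
    (hu : IsCaloric u)
    (h : ∀ j, ∀ p : EuclideanSpace ℝ (Fin n) × ℝ, p.2 ≤ 0 → dirDeriv (spaceDir j) u p = 0)
    {p₀ : EuclideanSpace ℝ (Fin n) × ℝ} (hp₀ : p₀.2 ≤ 0) (h0 : u p₀ = 0)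
    {p : EuclideanSpace ℝ (Fin n) × ℝ} (hp : p.2 ≤ 0) : u p = 0 := by
  have htime : ∀ p : EuclideanSpace ℝ (Fin n) × ℝ, p.2 ≤ 0 → dirDeriv (timeDir n) u p = 0 := by
    intro p hp
    rw [← hu.2 p hp]
    refine Finset.sum_eq_zero fun i _ => ?_
    have h1 := hasDerivAt_line (spaceDir i) (contDiff_dirDeriv (spaceDir i) hu.1) p 0
    have he : (fun s : ℝ => dirDeriv (spaceDir i) u (p + s • spaceDir i)) = fun _ => 0 :=
      funext fun s => h i _ (by simpa [spaceDir] using hp)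
    rw [he] at h1
    simpa using h1.unique (hasDerivAt_const (0 : ℝ) (0 : ℝ))
  have hfd : ∀ p : EuclideanSpace ℝ (Fin n) × ℝ, p.2 ≤ 0 → fderiv ℝ u p = 0 := by
    intro p hp
    ext w
    · have hb : ((fderiv ℝ u p).comp (ContinuousLinearMap.inl ℝ (EuclideanSpace ℝ (Fin n)) ℝ)
          : EuclideanSpace ℝ (Fin n) →ₗ[ℝ] ℝ) = 0 := by
        refine (EuclideanSpace.basisFun (Fin n) ℝ).toBasis.ext fun i => ?_
        simpa [dirDeriv, spaceDir] using h i p hp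
      simpa using LinearMap.congr_fun hb w
    · simpa [dirDeriv, timeDir] using htime p hp
  have hconv : Convex ℝ {p : EuclideanSpace ℝ (Fin n) × ℝ | p.2 ≤ 0} :=
    (convex_Iic (0 : ℝ)).linear_preimage (LinearMap.snd ℝ _ _)
  have := hconv.norm_image_sub_le_of_norm_hasFDerivWithin_le (C := 0)
    (fun p _ => (((hu.1.differentiable (by simp)) p).hasFDerivAt.hasFDerivWithinAt))
    (fun p hp => by rw [hfd p hp]; simp) hp₀ hp
  simpa [h0] using this

/-- Unique continuation for ancient solutions of polynomial growth. -/
lemma IsCaloric.eq_zero_of_eqOn_open {n : ℕ} (k : ℕ) :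
    ∀ {u : EuclideanSpace ℝ (Fin n) × ℝ → ℝ}, IsCaloric u → ∀ {c : ℝ},
      (∀ p : EuclideanSpace ℝ (Fin n) × ℝ, p.2 ≤ 0 → |u p| ≤ c * (‖p.1‖ + √|p.2| + 1) ^ k) →
      ∀ {U : Set (EuclideanSpace ℝ (Fin n) × ℝ)}, IsOpen U → ∀ {p₀}, p₀ ∈ U → p₀.2 ≤ 0 →
      (∀ p ∈ U, u p = 0) → ∀ p : EuclideanSpace ℝ (Fin n) × ℝ, p.2 ≤ 0 → u p = 0 := by
  induction k with
  | zero =>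
    intro u hu c hc U _ p₀ hp₀ hp₀' hU p hp
    refine hu.eq_zero_of_dirDeriv_eq_zero (fun j p hp => ?_) hp₀' (hU _ hp₀) hp
    by_contra hne
    have hpos := abs_pos.2 hne
    set d := |dirDeriv (spaceDir j) u p|
    have h1 := hu.growth_dirDeriv j hc hp
      (R := max (‖p.1‖ + √|p.2| + 1) ((√(13 + 2 * n) * c + 1) / d)) (le_max_left _ _)
    have h2 := mul_le_mul_of_nonneg_right
      (le_max_right (‖p.1‖ + √|p.2| + 1) ((√(13 + 2 * n) * c + 1) / d)) hpos.le
    rw [div_mul_cancel₀ _ hpos.ne'] at h2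
    simp only [pow_zero, mul_one] at h1
    linarith
  | succ k ih =>
    intro u hu c hc U hUo p₀ hp₀ hp₀' hU p hp
    refine hu.eq_zero_of_dirDeriv_eq_zero (fun j => ?_) hp₀' (hU _ hp₀) hp
    refine ih (hu.dirDeriv_spaceDir j) (c := √(13 + 2 * n) * (c * 3 ^ (k + 1))) ?_ hUo hp₀ hp₀' ?_
    · intro p hp
      have h1 := hu.growth_dirDeriv j hc hp le_rfl
      have hpos : 0 < ‖p.1‖ + √|p.2| + 1 := by positivity
      refine le_of_mul_le_mul_left (h1.trans_eq ?_) hpos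
      rw [mul_pow, pow_succ (‖p.1‖ + √|p.2| + 1)]
      ring
    · intro p hp
      have he : u =ᶠ[nhds p] fun _ => 0 := by
        filter_upwards [hUo.mem_nhds hp] with y hy using hU y hy
      simp [dirDeriv, he.fderiv_eq]

lemma continuous_parabolicDist {n : ℕ} (x₀ : EuclideanSpace ℝ (Fin n)) (t₀ : ℝ) :
    Continuous fun p : EuclideanSpace ℝ (Fin n) × ℝ => dist p.1 x₀ + √|t₀ - p.2| := by
  fun_prop

lemma isOpen_strict_Pb {n : ℕ} (R : ℝ) (x₀ : EuclideanSpace ℝ (Fin n)) (t₀ : ℝ) :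
    IsOpen {p : EuclideanSpace ℝ (Fin n) × ℝ | dist p.1 x₀ + √|t₀ - p.2| < R ∧ p.2 < t₀} :=
  (isOpen_lt (continuous_parabolicDist x₀ t₀) continuous_const).inter
    (isOpen_lt continuous_snd continuous_const)

lemma eq_zero_of_setIntegral_Pb_sq_eq_zero {n : ℕ} {u : EuclideanSpace ℝ (Fin n) × ℝ → ℝ}
    (hu : Continuous u) {R : ℝ} {x₀ : EuclideanSpace ℝ (Fin n)} {t₀ : ℝ}
    (h : ∫ p in Pb n R x₀ t₀, u p ^ 2 = 0) (p : EuclideanSpace ℝ (Fin n) × ℝ)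
    (hp : dist p.1 x₀ + √|t₀ - p.2| < R ∧ p.2 < t₀) : u p = 0 := by
  have hsub : Pb n R x₀ t₀ ⊆ Metric.closedBall x₀ R ×ˢ Set.Icc (t₀ - R ^ 2) t₀ := by
    rintro ⟨x, t⟩ ⟨h1, h2⟩
    simp only at h1 h2
    have h3 := Real.sqrt_nonneg |t₀ - t|
    have h4 := dist_nonneg (x := x) (y := x₀)
    refine ⟨by simp only [Metric.mem_closedBall]; linarith, ?_, h2⟩
    have h5 : √|t₀ - t| ^ 2 = t₀ - t := by
      rw [Real.sq_sqrt (abs_nonneg _), abs_of_nonneg (by linarith)]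
    simp only
    nlinarith
  have hmeas : MeasurableSet (Pb n R x₀ t₀) := by
    refine IsClosed.measurableSet ?_
    exact (isClosed_le (continuous_parabolicDist x₀ t₀) continuous_const).inter
      (isClosed_le continuous_snd continuous_const)
  have hint : IntegrableOn (fun p => u p ^ 2) (Pb n R x₀ t₀) :=
    (((hu.pow 2).continuousOn).integrableOn_compact
      ((isCompact_closedBall x₀ R).prod isCompact_Icc)).mono_set hsub
  have hae := (setIntegral_eq_zero_iff_of_nonneg_ae
    (Filter.Eventually.of_forall fun p => sq_nonneg (u p)) hint).1 h
  let U : Set (EuclideanSpace ℝ (Fin n) × ℝ) := {p | dist p.1 x₀ + √|t₀ - p.2| < R ∧ p.2 < t₀}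
  have hUP : U ⊆ Pb n R x₀ t₀ := fun p hp => ⟨hp.1.le, hp.2.le⟩
  have := Measure.eqOn_open_of_ae_eq (ae_restrict_of_ae_restrict_of_subset hUP hae)
    (isOpen_strict_Pb R x₀ t₀)
    (hu.pow 2).continuousOn continuousOn_const hp
  simpa using this

/-- for a finite-dimensional subspace `K` of `H^q(ℝⁿ × ℝ⁻)` there exists
`R₀ = R₀(K) > 0` such that for all `R ≥ R₀` and all `(x₀,t₀)`, the bilinear form
`(u,v) ↦ ∫_{P_R(x₀,t₀)} u v` is an inner product on `K`: in particular any `u ∈ K`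
with `∫_{P_R(x₀,t₀)} u² = 0` vanishes identically (on `ℝⁿ × (-∞,0]`). -/
theorem Hq_subspace_inner_product_large_R (n : ℕ) (q : ℝ) (hq : 1 ≤ q)
    (K : Submodule ℝ (EuclideanSpace ℝ (Fin n) × ℝ → ℝ))
    (hK : ∀ u ∈ K, InHq n q u)
    (hfd : FiniteDimensional ℝ K) :
    ∃ R₀ : ℝ, 0 < R₀ ∧ ∀ R : ℝ, R₀ ≤ R →
      ∀ (x₀ : EuclideanSpace ℝ (Fin n)) (t₀ : ℝ), t₀ ≤ 0 →
        ∀ u ∈ K, (∫ p in Pb n R x₀ t₀, (u p) ^ 2) = 0 →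
          ∀ (x : EuclideanSpace ℝ (Fin n)) (t : ℝ), t ≤ 0 → u (x, t) = 0 := by
  refine ⟨1, one_pos, fun R hR x₀ t₀ ht₀ u hu hint x t ht => ?_⟩
  obtain ⟨hheat, c, hc, hgrowth⟩ := hK u hu
  have hcal := hheat.isCaloric
  refine hcal.eq_zero_of_eqOn_open ⌈q⌉₊ (c := c) (fun p hp => ?_) (isOpen_strict_Pb R x₀ t₀)
    (p₀ := (x₀, t₀ - (1 / 2) ^ 2)) ?_ ?_
    (fun p hp => eq_zero_of_setIntegral_Pb_sq_eq_zero hcal.1.continuous hint p hp) (x, t) ht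
  · refine (hgrowth p.1 p.2 hp).trans ?_
    rw [← Real.rpow_natCast]
    have : 1 ≤ ‖p.1‖ + √|p.2| + 1 := by linarith [norm_nonneg p.1, Real.sqrt_nonneg |p.2|]
    gcongr
    exact Nat.le_ceil q
  · refine ⟨?_, by norm_num⟩
    have : t₀ - (t₀ - (1 / 2 : ℝ) ^ 2) = (1 / 2) ^ 2 := by ring
    simp only [this, dist_self, abs_pow, Real.sqrt_sq (abs_nonneg (1 / 2 : ℝ))]
    norm_num
    linarith
  · simp only
    norm_num
    linarith
end
end
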